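/- arXiv:1410.1835 — 2 statements merged into one kernel-verified Lean document; each statement's English description precedes it below -/
import Mathlib

section
/- Let E be a finite acyclic directed graph and K any field. Let w_1, ..., w_t be the sinks of E (a finite acyclic graph has at least one sink), and for each i let N_i be the number of paths in E whose range is w_i (counting w_i itself as a path of length 0). Then L_K(E) is isomorphic as a K-algebra to the direct sum ⊕_{i=1}^t M_{N_i}(K) of full matrix algebras. -/
/-- Generators of the Leavitt path algebra: vertices, edges, and ghost edges. -/
inductive LPAGen (V E : Type) : Type
  | vertex : V → LPAGen V E
  | edge : E → LPAGen V E
  | ghost : E → LPAGen V E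

/-- The defining relations of the Leavitt path algebra of a finite graph
(including the relation `∑ v = 1`, which presents the honest unital Leavitt path
algebra of a graph with finitely many vertices). -/
inductive LPARel (K : Type) [Field K] {V E : Type} [Fintype V] (s r : E → V) :
    FreeAlgebra K (LPAGen V E) → FreeAlgebra K (LPAGen V E) → Prop
  | vertex_self (v : V) :
      LPARel K s r (FreeAlgebra.ι K (LPAGen.vertex v) * FreeAlgebra.ι K (LPAGen.vertex v))
        (FreeAlgebra.ι K (LPAGen.vertex v))
  | vertex_ne {v w : V} (h : v ≠ w) :
      LPARel K s r (FreeAlgebra.ι K (LPAGen.vertex v) * FreeAlgebra.ι K (LPAGen.vertex w)) 0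
  | edge_left (e : E) :
      LPARel K s r (FreeAlgebra.ι K (LPAGen.vertex (s e)) * FreeAlgebra.ι K (LPAGen.edge e))
        (FreeAlgebra.ι K (LPAGen.edge e))
  | edge_right (e : E) :
      LPARel K s r (FreeAlgebra.ι K (LPAGen.edge e) * FreeAlgebra.ι K (LPAGen.vertex (r e)))
        (FreeAlgebra.ι K (LPAGen.edge e))
  | ghost_left (e : E) :
      LPARel K s r (FreeAlgebra.ι K (LPAGen.vertex (r e)) * FreeAlgebra.ι K (LPAGen.ghost e))
        (FreeAlgebra.ι K (LPAGen.ghost e))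
  | ghost_right (e : E) :
      LPARel K s r (FreeAlgebra.ι K (LPAGen.ghost e) * FreeAlgebra.ι K (LPAGen.vertex (s e)))
        (FreeAlgebra.ι K (LPAGen.ghost e))
  | ck1_self (e : E) :
      LPARel K s r (FreeAlgebra.ι K (LPAGen.ghost e) * FreeAlgebra.ι K (LPAGen.edge e))
        (FreeAlgebra.ι K (LPAGen.vertex (r e)))
  | ck1_ne {e f : E} (h : e ≠ f) :
      LPARel K s r (FreeAlgebra.ι K (LPAGen.ghost e) * FreeAlgebra.ι K (LPAGen.edge f)) 0
  | ck2 (v : V) (h : {e : E | s e = v}.Finite) (hne : {e : E | s e = v}.Nonempty) :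
      LPARel K s r (FreeAlgebra.ι K (LPAGen.vertex v))
        (h.toFinset.sum fun e => FreeAlgebra.ι K (LPAGen.edge e) * FreeAlgebra.ι K (LPAGen.ghost e))
  | unit :
      LPARel K s r (∑ v : V, FreeAlgebra.ι K (LPAGen.vertex v)) 1

/-- The Leavitt path algebra of a finite graph with coefficients in `K`. -/
abbrev LPA (K : Type) [Field K] {V E : Type} [Fintype V] (s r : E → V) : Type :=
  RingQuot (LPARel K s r)

variable (K : Type) [Field K] {V E : Type} [Fintype V] (s r : E → V)

/-- The canonical image of a generator in the Leavitt path algebra. -/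
def gen (g : LPAGen V E) : LPA K s r :=
  RingQuot.mkAlgHom K (LPARel K s r) (FreeAlgebra.ι K g)


def vertexEl (v : V) : LPA K s r := gen K s r (LPAGen.vertex v)
def edgeEl (e : E) : LPA K s r := gen K s r (LPAGen.edge e)
def ghostEl (e : E) : LPA K s r := gen K s r (LPAGen.ghost e)

/-- Paths in a directed graph: `IsPathFrom s r v w es` means the list of edges `es` is a
directed path from `v` to `w` (each vertex is a path of length `0`). -/
inductive IsPathFrom {V E : Type} (s r : E → V) : V → V → List E → Prop
  | nil (v : V) : IsPathFrom s r v v []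
  | cons (e : E) {w : V} {es : List E} :
      IsPathFrom s r (r e) w es → IsPathFrom s r (s e) w (e :: es)

/-- `v ≥ w` : there is a path from `v` to `w`. -/
def Geq {V E : Type} (s r : E → V) (v w : V) : Prop :=
  ∃ es : List E, IsPathFrom s r v w es

/-- A cycle based at `v` : a nonempty closed path whose source vertices are pairwise
distinct. -/
def IsCycle {V E : Type} (s r : E → V) (v : V) (es : List E) : Prop :=
  es ≠ [] ∧ IsPathFrom s r v v es ∧ (es.map s).Nodup

/-- A path (given by its list of edges) has an exit. -/
def HasExit {V E : Type} (s : E → V) (es : List E) : Prop :=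
  ∃ f : E, ∃ e ∈ es, s f = s e ∧ f ≠ e

/-- A set of vertices is hereditary. -/
def Hereditary {V E : Type} (s r : E → V) (X : Set V) : Prop :=
  ∀ v ∈ X, ∀ w : V, Geq s r v w → w ∈ X

/-- A set of vertices is saturated. -/
def Saturated {V E : Type} (s r : E → V) (X : Set V) : Prop :=
  ∀ v : V, {e : E | s e = v}.Finite → {e : E | s e = v}.Nonempty →
    (∀ e : E, s e = v → r e ∈ X) → v ∈ X

section MatrixUnits

variable {k A W : Type*} [Field k] [Ring A] [Algebra k A] {P : W → Type*}
  [Fintype W] [∀ w, Fintype (P w)]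

/-- The linear map sending a family of square matrices `M` to `∑ M w p q • (a w p * b w q)`. -/
def matrixUnitsMap (a b : ∀ w, P w → A) : (∀ w, Matrix (P w) (P w) k) →ₗ[k] A where
  toFun M := ∑ w, ∑ p, ∑ q, M w p q • (a w p * b w q)
  map_add' M N := by simp [add_smul, Finset.sum_add_distrib]
  map_smul' c M := by simp [mul_smul, Finset.smul_sum]

theorem matrixUnitsMap_apply (a b : ∀ w, P w → A) (M : ∀ w, Matrix (P w) (P w) k) :
    matrixUnitsMap a b M = ∑ w, ∑ p, ∑ q, M w p q • (a w p * b w q) := rfl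

variable {a b : ∀ w, P w → A} {c : W → A} [∀ w, DecidableEq (P w)]

theorem mul_mem_range_matrixUnitsMap (w : W) (p q : P w) :
    a w p * b w q ∈ LinearMap.range (matrixUnitsMap (k := k) a b) := by
  classical
  refine ⟨Pi.single w (Matrix.single p q 1), ?_⟩
  rw [matrixUnitsMap_apply, Finset.sum_eq_single w, Finset.sum_eq_single p,
    Finset.sum_eq_single q]
  · simp
  · intro q' _ h
    simp [h.symm]
  · simp
  · intro p' _ h
    simp [h.symm]
  · simp
  · intro w' _ h
    simp [h]
  · simp

theorem matrixUnitsMap_mul_right (hba : ∀ w p q, b w p * a w q = if p = q then c w else 0)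
    (hba' : ∀ w w' p q, w ≠ w' → b w p * a w' q = 0) (hac : ∀ w p, a w p * c w = a w p)
    (M : ∀ w, Matrix (P w) (P w) k) (w : W) (q : P w) :
    matrixUnitsMap a b M * a w q = ∑ p, M w p q • a w p := by
  rw [matrixUnitsMap_apply, Finset.sum_mul, Finset.sum_eq_single w]
  · rw [Finset.sum_mul]
    refine Finset.sum_congr rfl fun p _ => ?_
    simp [Finset.sum_mul, mul_assoc, hba, hac]
  · intro w' _ h
    simp [Finset.sum_mul, mul_assoc, hba' _ _ _ _ h]
  · simp

theorem matrixUnitsMap_mul (hba : ∀ w p q, b w p * a w q = if p = q then c w else 0)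
    (hba' : ∀ w w' p q, w ≠ w' → b w p * a w' q = 0) (hac : ∀ w p, a w p * c w = a w p)
    (M N : ∀ w, Matrix (P w) (P w) k) :
    matrixUnitsMap a b (M * N) = matrixUnitsMap a b M * matrixUnitsMap a b N := by
  rw [matrixUnitsMap_apply a b N, Finset.mul_sum, matrixUnitsMap_apply]
  refine Finset.sum_congr rfl fun w _ => ?_
  simp only [Finset.mul_sum, mul_smul_comm, ← mul_assoc,
    matrixUnitsMap_mul_right hba hba' hac, Finset.sum_mul, smul_mul_assoc, Finset.smul_sum,
    Pi.mul_apply, Matrix.mul_apply, Finset.sum_smul, smul_smul]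
  rw [Finset.sum_congr rfl fun p _ => Finset.sum_comm, Finset.sum_comm]
  refine Finset.sum_congr rfl fun p' _ => ?_
  rw [Finset.sum_comm]
  refine Finset.sum_congr rfl fun p _ => Finset.sum_congr rfl fun q _ => ?_
  rw [mul_comm]

theorem matrixUnitsMap_injective (hba : ∀ w p q, b w p * a w q = if p = q then c w else 0)
    (hba' : ∀ w w' p q, w ≠ w' → b w p * a w' q = 0) (hac : ∀ w p, a w p * c w = a w p)
    (hc : ∀ w, c w ≠ 0) : Function.Injective (matrixUnitsMap (k := k) a b) := by
  rw [injective_iff_map_eq_zero]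
  intro M hM
  ext w p q
  have h : b w p * (matrixUnitsMap a b M * a w q) = M w p q • c w := by
    rw [matrixUnitsMap_mul_right hba hba' hac, Finset.mul_sum]
    simp [hba]
  rw [hM] at h
  simpa [hc w] using h.symm

/-- A system of matrix units whose linear span is the whole algebra identifies the algebra with
a product of full matrix algebras. -/
theorem nonempty_algEquiv_of_matrixUnits
    (hba : ∀ w p q, b w p * a w q = if p = q then c w else 0)
    (hba' : ∀ w w' p q, w ≠ w' → b w p * a w' q = 0) (hac : ∀ w p, a w p * c w = a w p)
    (hc : ∀ w, c w ≠ 0) (hsurj : Function.Surjective (matrixUnitsMap (k := k) a b)) :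
    Nonempty ((∀ w, Matrix (P w) (P w) k) ≃ₐ[k] A) := by
  have hmul := matrixUnitsMap_mul (k := k) hba hba' hac
  have hone : matrixUnitsMap (k := k) a b 1 = 1 := by
    obtain ⟨M, hM⟩ := hsurj 1
    rw [← mul_one (matrixUnitsMap (k := k) a b 1), ← hM, ← hmul, one_mul]
  exact ⟨AlgEquiv.ofBijective (AlgHom.ofLinearMap (matrixUnitsMap a b) hone hmul)
    ⟨matrixUnitsMap_injective hba hba' hac hc, hsurj⟩⟩

end MatrixUnits

section Paths

variable {V E : Type} {s r : E → V}

theorem isPathFrom_nil_iff {v w : V} : IsPathFrom s r v w [] ↔ v = w :=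
  ⟨fun h => by cases h; rfl, fun h => h ▸ .nil v⟩

theorem isPathFrom_cons_iff {v w : V} {e : E} {es : List E} :
    IsPathFrom s r v w (e :: es) ↔ v = s e ∧ IsPathFrom s r (r e) w es := by
  constructor
  · intro h
    cases h with
    | cons _ h => exact ⟨rfl, h⟩
  · rintro ⟨rfl, h⟩
    exact .cons e h

theorem IsPathFrom.of_append_cons {v w : V} {es fs : List E} {f : E}
    (h : IsPathFrom s r v w (es ++ f :: fs)) : IsPathFrom s r v (s f) es := by
  induction es generalizing v with
  | nil =>
    rw [List.nil_append, isPathFrom_cons_iff] at h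
    exact isPathFrom_nil_iff.2 h.1
  | cons e es ih =>
    rw [List.cons_append, isPathFrom_cons_iff] at h
    exact isPathFrom_cons_iff.2 ⟨h.1, ih h.2⟩

theorem IsPathFrom.target_unique {v w w' : V} {es : List E} (h : IsPathFrom s r v w es)
    (h' : IsPathFrom s r v w' es) : w = w' := by
  induction h with
  | nil => exact isPathFrom_nil_iff.1 h'
  | cons e h ih => exact ih (isPathFrom_cons_iff.1 h').2

theorem IsPathFrom.nodup_map_source (hacyclic : ∀ (v : V) (es : List E), ¬ IsCycle s r v es)
    {v w : V} {es : List E} (h : IsPathFrom s r v w es) : (es.map s).Nodup := by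
  induction h with
  | nil v => simp
  | @cons e w es h ih =>
    rw [List.map_cons, List.nodup_cons]
    refine ⟨fun hmem => ?_, ih⟩
    obtain ⟨l₁, l₂, heq, hl₁⟩ := List.eq_append_cons_of_mem hmem
    obtain ⟨es₁, es₂, rfl, rfl, h₂⟩ := List.map_eq_append_iff.1 heq
    obtain ⟨f, es₃, rfl, hf, -⟩ := List.map_eq_cons_iff.1 h₂
    refine hacyclic (s e) (e :: es₁) ⟨by simp, .cons e (hf ▸ h.of_append_cons), ?_⟩
    rw [List.map_cons, List.nodup_cons]
    refine ⟨hl₁, ?_⟩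
    rw [List.map_append] at ih
    exact ih.of_append_left

theorem IsPathFrom.length_le [Fintype V] (hacyclic : ∀ (v : V) (es : List E), ¬ IsCycle s r v es)
    {v w : V} {es : List E} (h : IsPathFrom s r v w es) : es.length ≤ Fintype.card V := by
  simpa using (h.nodup_map_source hacyclic).length_le_card

theorem finite_paths_to [Fintype V] [Finite E]
    (hacyclic : ∀ (v : V) (es : List E), ¬ IsCycle s r v es) (w : V) :
    Finite {p : V × List E // IsPathFrom s r p.1 w p.2} := by
  have hfin := (Set.finite_univ (α := V)).prod (List.finite_length_le E (Fintype.card V))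
  exact (hfin.subset (t := {p : V × List E | IsPathFrom s r p.1 w p.2})
    fun p hp => ⟨trivial, IsPathFrom.length_le hacyclic hp⟩).to_subtype

end Paths

section Relations

variable {K s r}

theorem vertexEl_mul_self (v : V) : vertexEl K s r v * vertexEl K s r v = vertexEl K s r v := by
  simpa only [vertexEl, edgeEl, ghostEl, gen, map_mul] using
    RingQuot.mkAlgHom_rel K (LPARel.vertex_self (K := K) (s := s) (r := r) v)

theorem vertexEl_mul_of_ne {v w : V} (h : v ≠ w) :
    vertexEl K s r v * vertexEl K s r w = 0 := by
  simpa only [vertexEl, edgeEl, ghostEl, gen, map_mul, map_zero] using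
    RingQuot.mkAlgHom_rel K (LPARel.vertex_ne (K := K) (s := s) (r := r) h)

theorem vertexEl_mul_edgeEl (e : E) :
    vertexEl K s r (s e) * edgeEl K s r e = edgeEl K s r e := by
  simpa only [vertexEl, edgeEl, ghostEl, gen, map_mul] using
    RingQuot.mkAlgHom_rel K (LPARel.edge_left (K := K) (s := s) (r := r) e)

theorem edgeEl_mul_vertexEl (e : E) :
    edgeEl K s r e * vertexEl K s r (r e) = edgeEl K s r e := by
  simpa only [vertexEl, edgeEl, ghostEl, gen, map_mul] using
    RingQuot.mkAlgHom_rel K (LPARel.edge_right (K := K) (s := s) (r := r) e)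

theorem vertexEl_mul_ghostEl (e : E) :
    vertexEl K s r (r e) * ghostEl K s r e = ghostEl K s r e := by
  simpa only [vertexEl, edgeEl, ghostEl, gen, map_mul] using
    RingQuot.mkAlgHom_rel K (LPARel.ghost_left (K := K) (s := s) (r := r) e)

theorem ghostEl_mul_vertexEl (e : E) :
    ghostEl K s r e * vertexEl K s r (s e) = ghostEl K s r e := by
  simpa only [vertexEl, edgeEl, ghostEl, gen, map_mul] using
    RingQuot.mkAlgHom_rel K (LPARel.ghost_right (K := K) (s := s) (r := r) e)

theorem ghostEl_mul_edgeEl_self (e : E) :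
    ghostEl K s r e * edgeEl K s r e = vertexEl K s r (r e) := by
  simpa only [vertexEl, edgeEl, ghostEl, gen, map_mul] using
    RingQuot.mkAlgHom_rel K (LPARel.ck1_self (K := K) (s := s) (r := r) e)

theorem ghostEl_mul_edgeEl_of_ne {e f : E} (h : e ≠ f) :
    ghostEl K s r e * edgeEl K s r f = 0 := by
  simpa only [vertexEl, edgeEl, ghostEl, gen, map_mul, map_zero] using
    RingQuot.mkAlgHom_rel K (LPARel.ck1_ne (K := K) (s := s) (r := r) h)

theorem vertexEl_eq_sum (v : V) (h : {e : E | s e = v}.Finite)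
    (hne : {e : E | s e = v}.Nonempty) :
    vertexEl K s r v = ∑ e ∈ h.toFinset, edgeEl K s r e * ghostEl K s r e := by
  simpa only [vertexEl, edgeEl, ghostEl, gen, map_mul, map_sum] using
    RingQuot.mkAlgHom_rel K (LPARel.ck2 (K := K) (s := s) (r := r) v h hne)

theorem sum_vertexEl : ∑ v, vertexEl K s r v = 1 := by
  simpa only [vertexEl, edgeEl, ghostEl, gen, map_sum, map_one] using
    RingQuot.mkAlgHom_rel K (LPARel.unit (K := K) (s := s) (r := r))

theorem edgeEl_mul_vertexEl_of_ne {e : E} {v : V} (h : r e ≠ v) :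
    edgeEl K s r e * vertexEl K s r v = 0 := by
  rw [← edgeEl_mul_vertexEl, mul_assoc, vertexEl_mul_of_ne h, mul_zero]

theorem vertexEl_mul_edgeEl_of_ne {e : E} {v : V} (h : v ≠ s e) :
    vertexEl K s r v * edgeEl K s r e = 0 := by
  rw [← vertexEl_mul_edgeEl, ← mul_assoc, vertexEl_mul_of_ne h, zero_mul]

theorem ghostEl_mul_vertexEl_of_ne {e : E} {v : V} (h : s e ≠ v) :
    ghostEl K s r e * vertexEl K s r v = 0 := by
  rw [← ghostEl_mul_vertexEl, mul_assoc, vertexEl_mul_of_ne h, mul_zero]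

theorem vertexEl_mul_ghostEl_of_ne {e : E} {v : V} (h : v ≠ r e) :
    vertexEl K s r v * ghostEl K s r e = 0 := by
  rw [← vertexEl_mul_ghostEl, ← mul_assoc, vertexEl_mul_of_ne h, zero_mul]

end Relations

/-- The element of the Leavitt path algebra given by the path with edges `es` starting at `v`. -/
def pathEl (v : V) : List E → LPA K s r
  | [] => vertexEl K s r v
  | e :: es => edgeEl K s r e * pathEl (r e) es

/-- The element of the Leavitt path algebra given by the ghost of the path with edges `es`
starting at `v`. -/
def ghostPathEl (v : V) : List E → LPA K s r
  | [] => vertexEl K s r v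
  | e :: es => ghostPathEl (r e) es * ghostEl K s r e

section PathElements

variable {K s r}

theorem vertexEl_mul_pathEl {v w : V} {es : List E} (h : IsPathFrom s r v w es) :
    vertexEl K s r v * pathEl K s r v es = pathEl K s r v es := by
  cases h with
  | nil => exact vertexEl_mul_self v
  | cons e h => rw [pathEl, ← mul_assoc, vertexEl_mul_edgeEl]

theorem pathEl_mul_vertexEl {v w : V} {es : List E} (h : IsPathFrom s r v w es) :
    pathEl K s r v es * vertexEl K s r w = pathEl K s r v es := by
  induction h with
  | nil => exact vertexEl_mul_self _
  | cons e h ih => rw [pathEl, mul_assoc, ih]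

theorem ghostPathEl_mul_vertexEl {v w : V} {es : List E} (h : IsPathFrom s r v w es) :
    ghostPathEl K s r v es * vertexEl K s r v = ghostPathEl K s r v es := by
  cases h with
  | nil => exact vertexEl_mul_self v
  | cons e h => rw [ghostPathEl, mul_assoc, ghostEl_mul_vertexEl]

theorem ghostPathEl_mul_pathEl_self {v w : V} {es : List E} (h : IsPathFrom s r v w es) :
    ghostPathEl K s r v es * pathEl K s r v es = vertexEl K s r w := by
  induction h with
  | nil => exact vertexEl_mul_self _
  | cons e h ih =>
    rw [ghostPathEl, pathEl, mul_assoc, ← mul_assoc (ghostEl K s r e), ghostEl_mul_edgeEl_self,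
      vertexEl_mul_pathEl h, ih]

theorem ghostPathEl_mul_pathEl_of_ne {v v' w w' : V} {es es' : List E}
    (h : IsPathFrom s r v w es) (h' : IsPathFrom s r v' w' es') (hw : ∀ e, s e ≠ w)
    (hw' : ∀ e, s e ≠ w') (hne : (v, es) ≠ (v', es')) :
    ghostPathEl K s r v es * pathEl K s r v' es' = 0 := by
  induction h generalizing v' es' with
  | nil v =>
    cases h' with
    | nil => exact vertexEl_mul_of_ne fun h => hne (by rw [h])
    | cons e h' =>
      rw [ghostPathEl, pathEl, ← mul_assoc, vertexEl_mul_edgeEl_of_ne (hw e).symm, zero_mul]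
  | @cons e w es h ih =>
    cases h' with
    | nil =>
      rw [ghostPathEl, pathEl, mul_assoc, ghostEl_mul_vertexEl_of_ne (hw' e), mul_zero]
    | @cons e' _ es' h' =>
      rw [ghostPathEl, pathEl, mul_assoc, ← mul_assoc (ghostEl K s r e)]
      by_cases hee : e = e'
      · subst hee
        rw [ghostEl_mul_edgeEl_self, vertexEl_mul_pathEl h']
        refine ih h' hw fun heq => hne ?_
        rw [(Prod.mk.inj heq).2]
      · rw [ghostEl_mul_edgeEl_of_ne hee, zero_mul, mul_zero]

variable (K s r) in
/-- The linear span of the products `p q*`, for paths `p` and `q` ending at a common sink. -/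
def sinkSpan : Submodule K (LPA K s r) :=
  Submodule.span K {x | ∃ v v' w es es', (∀ e, s e ≠ w) ∧ IsPathFrom s r v w es ∧
    IsPathFrom s r v' w es' ∧ x = pathEl K s r v es * ghostPathEl K s r v' es'}

theorem edgeEl_mul_mem_sinkSpan (e : E) {x : LPA K s r} (hx : x ∈ sinkSpan K s r) :
    edgeEl K s r e * x ∈ sinkSpan K s r := by
  induction hx using Submodule.span_induction with
  | zero => simp
  | add x y _ _ hx hy => rw [mul_add]; exact add_mem hx hy
  | smul c x _ hx => rw [mul_smul_comm]; exact Submodule.smul_mem _ c hx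
  | mem x hx =>
    obtain ⟨v, v', w, es, es', hw, h, h', rfl⟩ := hx
    by_cases hv : r e = v
    · subst hv
      refine Submodule.subset_span ⟨s e, v', w, e :: es, es', hw, .cons e h, h', ?_⟩
      rw [pathEl, mul_assoc]
    · rw [← vertexEl_mul_pathEl h, ← mul_assoc, ← mul_assoc, edgeEl_mul_vertexEl_of_ne hv]
      simp

theorem mul_ghostEl_mem_sinkSpan (e : E) {x : LPA K s r} (hx : x ∈ sinkSpan K s r) :
    x * ghostEl K s r e ∈ sinkSpan K s r := by
  induction hx using Submodule.span_induction with
  | zero => simp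
  | add x y _ _ hx hy => rw [add_mul]; exact add_mem hx hy
  | smul c x _ hx => rw [smul_mul_assoc]; exact Submodule.smul_mem _ c hx
  | mem x hx =>
    obtain ⟨v, v', w, es, es', hw, h, h', rfl⟩ := hx
    by_cases hv : v' = r e
    · subst hv
      refine Submodule.subset_span ⟨v, s e, w, es, e :: es', hw, h, .cons e h', ?_⟩
      rw [ghostPathEl, mul_assoc]
    · rw [← ghostPathEl_mul_vertexEl h', mul_assoc, mul_assoc, vertexEl_mul_ghostEl_of_ne hv]
      simp

theorem vertexEl_mem_sinkSpan_of_length_le [Finite E] (n : ℕ) (v : V)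
    (h : ∀ w es, IsPathFrom s r v w es → es.length ≤ n) :
    vertexEl K s r v ∈ sinkSpan K s r := by
  induction n generalizing v with
  | zero =>
    refine Submodule.subset_span ⟨v, v, v, [], [], fun e he => ?_, .nil v, .nil v,
      (vertexEl_mul_self v).symm⟩
    simpa using h (r e) [e] (he ▸ .cons e (.nil _))
  | succ n ih =>
    by_cases hv : ∀ e, s e ≠ v
    · exact Submodule.subset_span ⟨v, v, v, [], [], hv, .nil v, .nil v,
        (vertexEl_mul_self v).symm⟩
    · push Not at hv
      rw [vertexEl_eq_sum v (Set.toFinite _) hv]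
      refine sum_mem fun e he => ?_
      have he : s e = v := by simpa using he
      rw [← edgeEl_mul_vertexEl]
      refine mul_ghostEl_mem_sinkSpan e (edgeEl_mul_mem_sinkSpan e (ih _ fun w es hes => ?_))
      simpa using h w (e :: es) (he ▸ .cons e hes)

theorem sinkSpan_mul_mem {x y : LPA K s r} (hx : x ∈ sinkSpan K s r) (hy : y ∈ sinkSpan K s r) :
    x * y ∈ sinkSpan K s r := by
  induction hx, hy using Submodule.span_induction₂ with
  | zero_left => simp
  | zero_right => simp
  | add_left x y z _ _ _ hx hy => rw [add_mul]; exact add_mem hx hy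
  | add_right x y z _ _ _ hx hy => rw [mul_add]; exact add_mem hx hy
  | smul_left c x y _ _ h => rw [smul_mul_assoc]; exact Submodule.smul_mem _ c h
  | smul_right c x y _ _ h => rw [mul_smul_comm]; exact Submodule.smul_mem _ c h
  | mem_mem x y hx hy =>
    obtain ⟨v₁, v₂, w, p₁, p₂, hw, h₁, h₂, rfl⟩ := hx
    obtain ⟨v₃, v₄, w', p₃, p₄, hw', h₃, h₄, rfl⟩ := hy
    rw [mul_assoc, ← mul_assoc (ghostPathEl K s r v₂ p₂)]
    by_cases heq : (v₂, p₂) = (v₃, p₃)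
    · cases heq
      cases h₂.target_unique h₃
      rw [ghostPathEl_mul_pathEl_self h₂, ← mul_assoc, pathEl_mul_vertexEl h₁]
      exact Submodule.subset_span ⟨v₁, v₄, w, p₁, p₄, hw, h₁, h₄, rfl⟩
    · rw [ghostPathEl_mul_pathEl_of_ne h₂ h₃ hw hw' heq]
      simp

theorem sinkSpan_eq_top [Finite E] (hacyclic : ∀ (v : V) (es : List E), ¬ IsCycle s r v es) :
    sinkSpan K s r = ⊤ := by
  have hvertex (v : V) : vertexEl K s r v ∈ sinkSpan K s r :=
    vertexEl_mem_sinkSpan_of_length_le _ v fun _ _ h => h.length_le hacyclic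
  have hone : (1 : LPA K s r) ∈ sinkSpan K s r := by
    rw [← sum_vertexEl]
    exact sum_mem fun v _ => hvertex v
  refine eq_top_iff.2 fun x _ => ?_
  obtain ⟨x, rfl⟩ := RingQuot.mkAlgHom_surjective K (LPARel K s r) x
  induction x using FreeAlgebra.induction with
  | grade0 c =>
    rw [AlgHom.commutes, Algebra.algebraMap_eq_smul_one]
    exact Submodule.smul_mem _ c hone
  | grade1 g =>
    cases g with
    | vertex v => exact hvertex v
    | edge e =>
      change edgeEl K s r e ∈ _
      rw [← edgeEl_mul_vertexEl]
      exact edgeEl_mul_mem_sinkSpan e (hvertex _)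
    | ghost e =>
      change ghostEl K s r e ∈ _
      rw [← vertexEl_mul_ghostEl]
      exact mul_ghostEl_mem_sinkSpan e (hvertex _)
  | mul x y hx hy => rw [map_mul]; exact sinkSpan_mul_mem (hx trivial) (hy trivial)
  | add x y hx hy => rw [map_add]; exact add_mem (hx trivial) (hy trivial)

end PathElements

section Representation

variable (K : Type) [Field K] {V E : Type} (s r : E → V)

/-- The paths ending at a sink, given by their source and their list of edges. -/
abbrev SinkPath : Type :=
  {p : V × List E // ∃ w, (∀ e, s e ≠ w) ∧ IsPathFrom s r p.1 w p.2}

variable {s r}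

/-- Prolong a path ending at a sink by an edge in front. -/
def SinkPath.cons (e : E) (x : SinkPath s r) (h : x.1.1 = r e) : SinkPath s r :=
  ⟨(s e, e :: x.1.2), x.2.imp fun _ hw => ⟨hw.1, .cons e (h ▸ hw.2)⟩⟩

/-- Remove the first edge of a path ending at a sink. -/
def SinkPath.tail (e : E) (x : SinkPath s r) (h : x.1.2.head? = some e) : SinkPath s r :=
  ⟨(r e, x.1.2.tail), x.2.imp fun _ hw => ⟨hw.1, by
    obtain ⟨es, hes⟩ := List.head?_eq_some_iff.1 h
    have hp := hw.2
    rw [hes, isPathFrom_cons_iff] at hp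
    simpa [hes] using hp.2⟩⟩

theorem SinkPath.source_eq {e : E} {x : SinkPath s r} (h : x.1.2.head? = some e) :
    x.1.1 = s e := by
  obtain ⟨w, -, hw⟩ := x.2
  obtain ⟨es, hes⟩ := List.head?_eq_some_iff.1 h
  rw [hes, isPathFrom_cons_iff] at hw
  exact hw.1

theorem SinkPath.cons_tail {e : E} {x : SinkPath s r} (h : x.1.2.head? = some e) :
    (x.tail e h).cons e rfl = x := by
  obtain ⟨es, hes⟩ := List.head?_eq_some_iff.1 h
  refine Subtype.ext (Prod.ext (SinkPath.source_eq h).symm ?_)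
  simp [SinkPath.cons, SinkPath.tail, hes]

theorem SinkPath.tail_cons {e : E} {x : SinkPath s r} (h : x.1.1 = r e) :
    (x.cons e h).tail e rfl = x :=
  Subtype.ext (Prod.ext h.symm rfl)

theorem SinkPath.exists_head {x : SinkPath s r} {e : E} (h : s e = x.1.1) :
    ∃ f, x.1.2.head? = some f := by
  obtain ⟨⟨v, es⟩, w, hw, hp⟩ := x
  cases es with
  | nil => exact absurd (h.trans (isPathFrom_nil_iff.1 hp)) (hw e)
  | cons f es => exact ⟨f, rfl⟩

open Classical in
variable (s r) in
/-- The action of the generators on functions on the paths ending at a sink. -/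
noncomputable def sinkRepGen : LPAGen V E → Module.End K (SinkPath s r → K)
  | .vertex v =>
    { toFun f x := if x.1.1 = v then f x else 0
      map_add' f g := by ext x; dsimp; split_ifs <;> simp
      map_smul' c f := by ext x; dsimp; split_ifs <;> simp }
  | .edge e =>
    { toFun f x := if h : x.1.2.head? = some e then f (x.tail e h) else 0
      map_add' f g := by ext x; dsimp; split_ifs <;> simp
      map_smul' c f := by ext x; dsimp; split_ifs <;> simp }
  | .ghost e =>
    { toFun f x := if h : x.1.1 = r e then f (x.cons e h) else 0
      map_add' f g := by ext x; dsimp; split_ifs <;> simp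
      map_smul' c f := by ext x; dsimp; split_ifs <;> simp }

open Classical in
theorem sinkRepGen_vertex_apply (v : V) (f : SinkPath s r → K) (x : SinkPath s r) :
    sinkRepGen K s r (.vertex v) f x = if x.1.1 = v then f x else 0 := rfl

open Classical in
theorem sinkRepGen_edge_apply (e : E) (f : SinkPath s r → K) (x : SinkPath s r) :
    sinkRepGen K s r (.edge e) f x =
      if h : x.1.2.head? = some e then f (x.tail e h) else 0 := rfl

open Classical in
theorem sinkRepGen_ghost_apply (e : E) (f : SinkPath s r → K) (x : SinkPath s r) :
    sinkRepGen K s r (.ghost e) f x = if h : x.1.1 = r e then f (x.cons e h) else 0 := rfl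

theorem sinkRepGen_rel [Fintype V] {x y : FreeAlgebra K (LPAGen V E)} (h : LPARel K s r x y) :
    FreeAlgebra.lift K (sinkRepGen K s r) x = FreeAlgebra.lift K (sinkRepGen K s r) y := by
  classical
  cases h with
  | vertex_self v =>
    ext f x
    simp +contextual [sinkRepGen_vertex_apply]
  | vertex_ne h =>
    ext f x
    simp only [map_mul, FreeAlgebra.lift_ι_apply, Module.End.mul_apply, sinkRepGen_vertex_apply,
      map_zero, LinearMap.zero_apply, Pi.zero_apply]
    grind
  | edge_left e =>
    ext f x
    simp only [map_mul, FreeAlgebra.lift_ι_apply, Module.End.mul_apply, sinkRepGen_vertex_apply,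
      sinkRepGen_edge_apply]
    split_ifs with h₁ h₂ h₂
    · rfl
    · rfl
    · exact absurd (SinkPath.source_eq h₂) h₁
    · rfl
  | edge_right e =>
    ext f x
    simp [sinkRepGen_vertex_apply, sinkRepGen_edge_apply, SinkPath.tail]
  | ghost_left e =>
    ext f x
    simp only [map_mul, FreeAlgebra.lift_ι_apply, Module.End.mul_apply, sinkRepGen_vertex_apply,
      sinkRepGen_ghost_apply]
    split_ifs <;> rfl
  | ghost_right e =>
    ext f x
    simp [sinkRepGen_vertex_apply, sinkRepGen_ghost_apply, SinkPath.cons]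
  | ck1_self e =>
    ext f x
    simp only [map_mul, FreeAlgebra.lift_ι_apply, Module.End.mul_apply, sinkRepGen_vertex_apply,
      sinkRepGen_ghost_apply, sinkRepGen_edge_apply]
    split_ifs with h₁ h₂
    · rw [SinkPath.tail_cons]
    · exact absurd rfl h₂
    · rfl
  | ck1_ne h =>
    ext f x
    simp [sinkRepGen_ghost_apply, sinkRepGen_edge_apply, SinkPath.cons, h]
  | ck2 v h hne =>
    ext f x
    simp only [map_mul, map_sum, FreeAlgebra.lift_ι_apply, LinearMap.sum_apply, Finset.sum_apply,
      Module.End.mul_apply, sinkRepGen_vertex_apply, sinkRepGen_ghost_apply,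
      sinkRepGen_edge_apply]
    split_ifs with hx
    · obtain ⟨e₀, he₀⟩ := hne
      obtain ⟨e, he⟩ := SinkPath.exists_head (he₀.trans hx.symm)
      rw [Finset.sum_eq_single e]
      · rw [dif_pos he, dif_pos (show (x.tail e he).1.1 = r e from rfl), SinkPath.cons_tail]
      · intro e' _ hne'
        rw [dif_neg]
        rw [he]
        exact fun h => hne' (Option.some.inj h).symm
      · intro hmem
        exact absurd (by simpa using (SinkPath.source_eq he).symm.trans hx) hmem
    · refine (Finset.sum_eq_zero fun e he => dif_neg fun hh => hx ?_).symm
      rw [SinkPath.source_eq hh]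
      simpa using he
  | unit =>
    ext f x
    simp [sinkRepGen_vertex_apply]

theorem vertexEl_ne_zero_of_sink [Fintype V] {w : V} (hw : ∀ e, s e ≠ w) :
    vertexEl K s r w ≠ 0 := by
  intro h
  have h₁ := congrArg (RingQuot.liftAlgHom K
    ⟨FreeAlgebra.lift K (sinkRepGen K s r), fun _ _ => sinkRepGen_rel K⟩) h
  rw [vertexEl, gen, RingQuot.liftAlgHom_mkAlgHom_apply, FreeAlgebra.lift_ι_apply, map_zero] at h₁
  have h₂ := congrFun (LinearMap.congr_fun h₁ 1) ⟨(w, []), w, hw, .nil w⟩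
  simp [sinkRepGen_vertex_apply] at h₂

end Representation

/-- **Structure Theorem for Leavitt path algebras of finite acyclic graphs.**
If `E` is a finite acyclic graph with sinks `w₁, …, w_t`, and `N_i` is the number of
paths of `E` with range `w_i`, then `L_K(E) ≅ ⊕_{i=1}^t M_{N_i}(K)` as `K`-algebras. -/
theorem finite_acyclic_structure (K V E : Type) [Field K] [Fintype V] [Fintype E]
    (s r : E → V)
    (hacyclic : ∀ (v : V) (es : List E), ¬ IsCycle s r v es) :
    Nonempty (LPA K s r ≃ₐ[K]
      (∀ w : {w : V // ∀ e : E, s e ≠ w},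
        Matrix (Fin (Nat.card {p : V × List E // IsPathFrom s r p.1 w.1 p.2}))
          (Fin (Nat.card {p : V × List E // IsPathFrom s r p.1 w.1 p.2})) K)) := by
  classical
  have hfin (w : {w : V // ∀ e : E, s e ≠ w}) := finite_paths_to hacyclic w.1
  let (w : {w : V // ∀ e : E, s e ≠ w}) :
      Fintype {p : V × List E // IsPathFrom s r p.1 w.1 p.2} := Fintype.ofFinite _
  let a (w : {w : V // ∀ e : E, s e ≠ w}) (p : {p : V × List E // IsPathFrom s r p.1 w.1 p.2}) :
      LPA K s r := pathEl K s r p.1.1 p.1.2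
  let b (w : {w : V // ∀ e : E, s e ≠ w}) (p : {p : V × List E // IsPathFrom s r p.1 w.1 p.2}) :
      LPA K s r := ghostPathEl K s r p.1.1 p.1.2
  obtain ⟨φ⟩ := nonempty_algEquiv_of_matrixUnits (k := K) (a := a) (b := b)
    (c := fun w => vertexEl K s r w.1)
    (fun w p q => by
      split_ifs with h
      · subst h
        exact ghostPathEl_mul_pathEl_self p.2
      · exact ghostPathEl_mul_pathEl_of_ne p.2 q.2 w.2 w.2 fun heq => h (Subtype.ext heq))
    (fun w w' p q h => ghostPathEl_mul_pathEl_of_ne p.2 q.2 w.2 w'.2 fun heq => by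
      have hpq : p.1 = q.1 := heq
      have hp := p.2
      rw [hpq] at hp
      exact h (Subtype.ext (hp.target_unique q.2)))
    (fun w p => pathEl_mul_vertexEl p.2)
    (fun w => vertexEl_ne_zero_of_sink K w.2)
    (LinearMap.range_eq_top.1 (eq_top_iff.2 (by
      rw [← sinkSpan_eq_top hacyclic, sinkSpan, Submodule.span_le]
      rintro _ ⟨v, v', w, es, es', hw, h, h', rfl⟩
      exact mul_mem_range_matrixUnitsMap (a := a) (b := b) ⟨w, hw⟩ ⟨(v, es), h⟩ ⟨(v', es'), h'⟩)))
  exact ⟨φ.symm.trans (AlgEquiv.piCongrRight fun w =>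
    Matrix.reindexAlgEquiv K K (Finite.equivFin _))⟩
end

section
/- Let n ≥ 2 and d, d' be positive integers and K any field. Then L_K(1,n) ≅ M_d(L_K(1,n)) as K-algebras if and only if gcd(d, n-1) = 1. More generally, M_d(L_K(1,n)) ≅ M_{d'}(L_K(1,n)) as K-algebras if and only if gcd(d, n-1) = gcd(d', n-1). -/
/-- The defining relations of the Leavitt algebra `L_K(1,n)`: generators
`x₁, …, xₙ` (encoded as `Sum.inl i`) and `y₁, …, yₙ` (encoded as `Sum.inr i`), subject to
`yᵢ xⱼ = δᵢⱼ 1` and `∑ᵢ xᵢ yᵢ = 1`. -/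
inductive LeavittRel (K : Type) [Field K] (n : ℕ) :
    FreeAlgebra K (Fin n ⊕ Fin n) → FreeAlgebra K (Fin n ⊕ Fin n) → Prop
  | yx_self (i : Fin n) :
      LeavittRel K n (FreeAlgebra.ι K (Sum.inr i) * FreeAlgebra.ι K (Sum.inl i)) 1
  | yx_ne {i j : Fin n} (h : i ≠ j) :
      LeavittRel K n (FreeAlgebra.ι K (Sum.inr i) * FreeAlgebra.ι K (Sum.inl j)) 0
  | xy_sum :
      LeavittRel K n (∑ i : Fin n, FreeAlgebra.ι K (Sum.inl i) * FreeAlgebra.ι K (Sum.inr i)) 1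

/-- The Leavitt algebra `L_K(1,n)` of type `(1,n)`. -/
abbrev LeavittAlgebra (K : Type) [Field K] (n : ℕ) : Type :=
  RingQuot (LeavittRel K n)


open Matrix

/-! ### Leavitt families and rectangular invertible matrices -/

/-- A family of elements satisfying the defining relations of a Leavitt algebra. -/
structure IsLeavittFamily {ι R : Type*} [Fintype ι] [DecidableEq ι] [Ring R] (x y : ι → R) :
    Prop where
  yx : ∀ i j, y i * x j = if i = j then 1 else 0
  sum_xy : ∑ i, x i * y i = 1

theorem IsLeavittFamily.map {ι R S F : Type*} [Fintype ι] [DecidableEq ι] [Ring R] [Ring S]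
    [FunLike F R S] [RingHomClass F R S] {x y : ι → R} (h : IsLeavittFamily x y) (f : F) :
    IsLeavittFamily (fun i => f (x i)) (fun i => f (y i)) where
  yx i j := by rw [← map_mul, h.yx]; split_ifs <;> simp
  sum_xy := by simp only [← map_mul, ← map_sum, h.sum_xy, map_one]

/-- The free modules over `R` on `ι` and on `κ` are isomorphic, expressed by matrices. -/
def RectIso (R ι κ : Type*) [Ring R] [Fintype ι] [Fintype κ] [DecidableEq ι] [DecidableEq κ] :
    Prop :=
  ∃ (A : Matrix ι κ R) (B : Matrix κ ι R), A * B = 1 ∧ B * A = 1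

namespace RectIso

variable {R ι κ μ ι' κ' : Type*} [Ring R] [Fintype ι] [Fintype κ] [Fintype μ] [Fintype ι']
  [Fintype κ'] [DecidableEq ι] [DecidableEq κ] [DecidableEq μ] [DecidableEq ι'] [DecidableEq κ']

theorem of_equiv (e : ι ≃ κ) : RectIso R ι κ :=
  ⟨(1 : Matrix κ κ R).submatrix e id, (1 : Matrix κ κ R).submatrix id e, by
    rw [← Matrix.submatrix_mul _ _ _ _ _ Function.bijective_id]; simp, by
    rw [Matrix.submatrix_mul_equiv]; simp⟩

theorem trans (h : RectIso R ι κ) (h' : RectIso R κ μ) : RectIso R ι μ := by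
  obtain ⟨A, B, h₁, h₂⟩ := h
  obtain ⟨C, D, h₃, h₄⟩ := h'
  refine ⟨A * C, D * B, ?_, ?_⟩
  · rw [Matrix.mul_assoc, ← Matrix.mul_assoc C, h₃, Matrix.one_mul, h₁]
  · rw [Matrix.mul_assoc, ← Matrix.mul_assoc B, h₂, Matrix.one_mul, h₄]

theorem sum (h : RectIso R ι κ) (h' : RectIso R ι' κ') : RectIso R (ι ⊕ ι') (κ ⊕ κ') := by
  obtain ⟨A, B, h₁, h₂⟩ := h
  obtain ⟨C, D, h₃, h₄⟩ := h'
  refine ⟨fromBlocks A 0 0 C, fromBlocks B 0 0 D, ?_, ?_⟩ <;>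
    simp [fromBlocks_multiply, h₁, h₂, h₃, h₄]

theorem nonempty_algEquiv (K : Type*) [CommRing K] [Algebra K R] (h : RectIso R ι κ) :
    Nonempty (Matrix ι ι R ≃ₐ[K] Matrix κ κ R) := by
  obtain ⟨A, B, h₁, h₂⟩ := h
  refine ⟨AlgEquiv.ofLinearEquiv
    { toFun := fun X => B * X * A
      invFun := fun X => A * X * B
      map_add' := fun X Y => by simp [Matrix.mul_add, Matrix.add_mul]
      map_smul' := fun c X => by simp
      left_inv := fun X => ?_
      right_inv := fun X => ?_ } ?_ ?_⟩
  · beta_reduce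
    rw [← Matrix.mul_assoc, ← Matrix.mul_assoc, h₁, Matrix.one_mul, Matrix.mul_assoc, h₁, Matrix.mul_one]
  · beta_reduce
    rw [← Matrix.mul_assoc, ← Matrix.mul_assoc, h₂, Matrix.one_mul, Matrix.mul_assoc, h₂, Matrix.mul_one]
  · simp [h₂]
  · intro X Y
    simp only [LinearEquiv.coe_mk, LinearMap.coe_mk, AddHom.coe_mk]
    simp only [Matrix.mul_assoc]
    rw [← Matrix.mul_assoc A B, h₁, Matrix.one_mul]

theorem exists_isLeavittFamily (h : RectIso R ι (κ × ι)) :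
    ∃ x y : κ → Matrix ι ι R, IsLeavittFamily x y := by
  obtain ⟨A, B, h₁, h₂⟩ := h
  refine ⟨fun k => Matrix.of fun i j => A i (k, j), fun k => Matrix.of fun i j => B (k, i) j,
    fun k l => ?_, ?_⟩
  · ext i j
    have := congrFun (congrFun h₂ (k, i)) (l, j)
    rw [Matrix.mul_apply] at this ⊢
    simp only [Matrix.of_apply]
    rw [this]
    by_cases hkl : k = l <;> simp [Matrix.one_apply, hkl]
  · ext i j
    have := congrFun (congrFun h₁ i) j
    rw [Matrix.mul_apply, Fintype.sum_prod_type] at this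
    rw [Matrix.sum_apply, ← this]
    simp [Matrix.mul_apply]

theorem of_isLeavittFamily {x y : κ → Matrix ι ι R} (h : IsLeavittFamily x y) :
    RectIso R ι (κ × ι) := by
  refine ⟨Matrix.of fun i p => x p.1 i p.2, Matrix.of fun p j => y p.1 p.2 j, ?_, ?_⟩
  · ext i j
    rw [← h.sum_xy, Matrix.mul_apply, Fintype.sum_prod_type, Matrix.sum_apply]
    simp [Matrix.mul_apply]
  · ext ⟨k, i⟩ ⟨l, j⟩
    have := congrFun (congrFun (h.yx k l) i) j
    rw [Matrix.mul_apply] at this ⊢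
    simp only [Matrix.of_apply]
    rw [this]
    by_cases hkl : k = l <;> simp [Matrix.one_apply, hkl]

theorem of_unit {x y : κ → R} (h : IsLeavittFamily x y) : RectIso R Unit κ := by
  refine ⟨Matrix.of fun _ k => x k, Matrix.of fun k _ => y k, ?_, ?_⟩
  · ext
    simpa [Matrix.mul_apply] using h.sum_xy
  · ext k l
    simpa [Matrix.mul_apply, Matrix.one_apply] using h.yx k l

theorem fin_add {m : ℕ} {x y : Fin (m + 1) → R} (h : IsLeavittFamily x y) {p : ℕ} (hp : 0 < p)
    (j : ℕ) : RectIso R (Fin p) (Fin (p + j * m)) := by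
  induction j with
  | zero => exact of_equiv (finCongr (by simp))
  | succ j ih =>
    refine ih.trans ?_
    obtain ⟨q, hq⟩ : ∃ q, p + j * m = q + 1 := ⟨p + j * m - 1, by omega⟩
    have e₁ : Fin (p + j * m) ≃ Fin q ⊕ Unit :=
      Fintype.equivOfCardEq (by simp [hq])
    have e₂ : Fin q ⊕ Fin (m + 1) ≃ Fin (p + (j + 1) * m) :=
      Fintype.equivOfCardEq (by simp; linarith)
    exact ((of_equiv e₁).trans ((of_equiv (Equiv.refl _)).sum (of_unit h))).trans (of_equiv e₂)

end RectIso

/-! ### Words in the generators -/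

section Words

variable {ι R : Type*} [Ring R]

/-- The product of the `y i` along a word. -/
def yWord (y : ι → R) (l : List ι) : R := (l.map y).prod

/-- The product of the `x i` along the reversed word. -/
def xWord (x : ι → R) (l : List ι) : R := (l.map x).reverse.prod

@[simp] theorem yWord_nil (y : ι → R) : yWord y [] = 1 := rfl

@[simp] theorem yWord_cons (y : ι → R) (i : ι) (l : List ι) :
    yWord y (i :: l) = y i * yWord y l := by simp [yWord]

theorem yWord_append (y : ι → R) (l l' : List ι) :
    yWord y (l ++ l') = yWord y l * yWord y l' := by simp [yWord]

@[simp] theorem xWord_nil (x : ι → R) : xWord x [] = 1 := rfl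

@[simp] theorem xWord_cons (x : ι → R) (i : ι) (l : List ι) :
    xWord x (i :: l) = xWord x l * x i := by simp [xWord]

variable (K : Type*) [Field K] [Algebra K R]

/-- The span of the `y`-words of length at least `N`. -/
def wordSpan (y : ι → R) (N : ℕ) : Submodule K R :=
  Submodule.span K (yWord y '' {l | N ≤ l.length})

variable {K}

theorem yWord_mem_wordSpan {y : ι → R} {N : ℕ} {l : List ι} (h : N ≤ l.length) :
    yWord y l ∈ wordSpan K y N := Submodule.subset_span ⟨l, h, rfl⟩

theorem wordSpan_anti (y : ι → R) {N M : ℕ} (h : N ≤ M) : wordSpan K y M ≤ wordSpan K y N :=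
  Submodule.span_mono (Set.image_mono fun _ hl => h.trans hl)

theorem mul_mem_of_yWord_mul_mem {y : ι → R} {N : ℕ} {V : Submodule K R} {a : R}
    (h : ∀ l : List ι, N ≤ l.length → yWord y l * a ∈ V) {f : R} (hf : f ∈ wordSpan K y N) :
    f * a ∈ V := by
  have : wordSpan K y N ≤ V.comap (LinearMap.mulRight K a) :=
    Submodule.span_le.2 (by rintro _ ⟨l, hl, rfl⟩; exact h l hl)
  exact this hf

variable [Fintype ι] [DecidableEq ι] {x y : ι → R}

theorem IsLeavittFamily.exists_wordSpan_mul_mem (h : IsLeavittFamily x y)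
    (hgen : Algebra.adjoin K (Set.range x ∪ Set.range y) = ⊤) (a : R) (T : ℕ) :
    ∃ N, ∀ f ∈ wordSpan K y N, f * a ∈ wordSpan K y T := by
  have ha : a ∈ Algebra.adjoin K (Set.range x ∪ Set.range y) := hgen ▸ Algebra.mem_top
  induction ha using Algebra.adjoin_induction generalizing T with
  | mem a ha =>
    rcases ha with ⟨i, rfl⟩ | ⟨i, rfl⟩
    · refine ⟨T + 1, fun f hf => mul_mem_of_yWord_mul_mem (fun l hl => ?_) hf⟩
      have hne : l ≠ [] := by rintro rfl; simp at hl
      rw [← List.dropLast_append_getLast hne, yWord_append]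
      simp only [yWord_cons, yWord_nil, mul_one]
      rw [mul_assoc, h.yx]
      split_ifs
      · rw [mul_one]
        exact yWord_mem_wordSpan (by simp; omega)
      · simp
    · refine ⟨T, fun f hf => mul_mem_of_yWord_mul_mem (fun l hl => ?_) hf⟩
      have : yWord y l * y i = yWord y (l ++ [i]) := by simp [yWord_append]
      rw [this]
      exact yWord_mem_wordSpan (by simp; omega)
  | algebraMap r =>
    refine ⟨T, fun f hf => ?_⟩
    rw [← Algebra.commutes, ← Algebra.smul_def]
    exact Submodule.smul_mem _ _ hf
  | add a b _ _ iha ihb =>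
    obtain ⟨N, hN⟩ := iha T
    obtain ⟨M, hM⟩ := ihb T
    refine ⟨max N M, fun f hf => ?_⟩
    rw [mul_add]
    exact add_mem (hN f (wordSpan_anti y (le_max_left _ _) hf))
      (hM f (wordSpan_anti y (le_max_right _ _) hf))
  | mul a b _ _ iha ihb =>
    obtain ⟨M, hM⟩ := ihb T
    obtain ⟨N, hN⟩ := iha M
    exact ⟨N, fun f hf => by rw [← mul_assoc]; exact hM _ (hN _ hf)⟩

theorem IsLeavittFamily.exists_yWord_mul_ne_zero (h : IsLeavittFamily x y) {a : R} (ha : a ≠ 0)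
    (N : ℕ) : ∃ l : List ι, l.length = N ∧ yWord y l * a ≠ 0 := by
  induction N with
  | zero => exact ⟨[], rfl, by simpa⟩
  | succ N ih =>
    obtain ⟨l, hl, hne⟩ := ih
    by_contra! hcon
    apply hne
    rw [← one_mul (yWord y l * a), ← h.sum_xy, Finset.sum_mul]
    refine Finset.sum_eq_zero fun i _ => ?_
    rw [mul_assoc, ← mul_assoc (y i), ← yWord_cons, hcon _ (by simp [hl]), mul_zero]

theorem IsLeavittFamily.yWord_mul_xWord (h : IsLeavittFamily x y) {l l' : List ι}
    (hl : l.length = l'.length) : yWord y l * xWord x l' = if l = l' then 1 else 0 := by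
  induction l generalizing l' with
  | nil => cases l' <;> simp_all
  | cons i l ih =>
    cases l' with
    | nil => simp at hl
    | cons j l' =>
      rw [yWord_cons, xWord_cons, mul_assoc, ← mul_assoc (yWord y l), ih (by simpa using hl)]
      by_cases hll : l = l' <;> simp [hll, h.yx]

end Words

/-! ### Simplicity -/

section Simple

variable {R : Type*} [Ring R] {m : ℕ} {x y : Fin (m + 1) → R}

theorem IsLeavittFamily.yWord_mul_pow (h : IsLeavittFamily x y) (i : Fin (m + 1)) {D : ℕ}
    {l : List (Fin (m + 1))} (hl : l.length ≤ D) :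
    yWord y l * x i ^ D = 0 ∨ yWord y l * x i ^ D = x i ^ (D - l.length) := by
  induction l with
  | nil => simp
  | cons j l ih =>
    simp only [List.length_cons] at hl
    rw [yWord_cons, mul_assoc]
    rcases ih (by omega) with h0 | h1
    · simp [h0]
    · rw [h1, show D - l.length = (D - (l.length + 1)) + 1 by omega, pow_succ', ← mul_assoc, h.yx]
      split_ifs <;> simp

theorem IsLeavittFamily.pow_mul_pow (h : IsLeavittFamily x y) (i : Fin (m + 1)) (D : ℕ) :
    y i ^ D * x i ^ D = 1 := by
  induction D with
  | zero => simp
  | succ D ih =>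
    rw [pow_succ, pow_succ', mul_assoc, ← mul_assoc (y i), h.yx, if_pos rfl, one_mul, ih]

theorem IsLeavittFamily.pow_mul_pow_of_lt (h : IsLeavittFamily x y) (i : Fin (m + 1)) {D E : ℕ}
    (hDE : D ≤ E) : y i ^ E * x i ^ D = y i ^ (E - D) := by
  rw [← Nat.sub_add_cancel hDE, pow_add, mul_assoc, h.pow_mul_pow, mul_one, Nat.add_sub_cancel]

theorem IsLeavittFamily.exists_mul_mul_eq_one {K : Type*} [Field K] [Algebra K R]
    (h : IsLeavittFamily x y) (hm : 0 < m)
    (hgen : Algebra.adjoin K (Set.range x ∪ Set.range y) = ⊤) {a : R} (ha : a ≠ 0) :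
    ∃ p q, p * a * q = 1 := by
  obtain ⟨N, hN⟩ := h.exists_wordSpan_mul_mem hgen a 0
  obtain ⟨l, hl, hne⟩ := h.exists_yWord_mul_ne_zero ha N
  have hmem := hN _ (yWord_mem_wordSpan hl.ge)
  obtain ⟨c, -, hc⟩ := (Finsupp.mem_span_image_iff_linearCombination K).1 hmem
  have hc0 : c.support.Nonempty := by
    rw [Finsupp.support_nonempty_iff]
    rintro rfl
    exact hne (by simpa using hc.symm)
  obtain ⟨v, hv, hmin⟩ := Finset.exists_min_image c.support List.length hc0
  set D := c.support.sup List.length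
  let o : Fin (m + 1) := ⟨1, by omega⟩
  have ho : o ≠ 0 := by simp [o, Fin.ext_iff]
  have key : ∀ u ∈ c.support, y o * y 0 ^ D * (yWord y u * xWord x v) * (x 0 ^ D * x o) =
      if u = v then 1 else 0 := by
    intro u hu
    have hvu := hmin u hu
    have huD : u.length ≤ D := Finset.le_sup (f := List.length) hu
    have hsplit := List.take_append_drop (u.length - v.length) u
    rw [← hsplit, yWord_append, mul_assoc (yWord y _), h.yWord_mul_xWord (by simp; omega), hsplit]
    by_cases huv : u = v
    · subst huv
      simp only [Nat.sub_self, List.drop_zero, if_true, List.take_zero, yWord_nil, mul_one]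
      rw [mul_assoc, ← mul_assoc (y 0 ^ D), h.pow_mul_pow, one_mul, h.yx, if_pos rfl]
    · rw [if_neg huv]
      split_ifs with hd
      · have hlt : v.length < u.length := by
          refine lt_of_le_of_ne hvu fun heq => huv ?_
          simpa [heq] using hd
        set t := u.take (u.length - v.length) with ht
        have htl : t.length = u.length - v.length := by simp [ht]
        rw [mul_one, mul_assoc, ← mul_assoc (yWord y t)]
        rcases h.yWord_mul_pow 0 (D := D) (l := t) (by omega) with h0 | h1
        · rw [h0]; simp
        · rw [h1, mul_assoc, ← mul_assoc (y 0 ^ D), h.pow_mul_pow_of_lt 0 (by omega),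
            show D - (D - t.length) = t.length - 1 + 1 by omega, pow_succ, mul_assoc (y 0 ^ _),
            h.yx, if_neg ho.symm]
          simp
      · simp
  have hcv : c v ≠ 0 := Finsupp.mem_support_iff.1 hv
  refine ⟨(c v)⁻¹ • (y o * y 0 ^ D) * yWord y l, xWord x v * (x 0 ^ D * x o), ?_⟩
  rw [mul_assoc _ (yWord y l), ← hc, Finsupp.linearCombination_apply, Finsupp.sum,
    smul_mul_assoc, smul_mul_assoc, Finset.mul_sum, Finset.sum_mul]
  have : ∀ u ∈ c.support, y o * y 0 ^ D * c u • yWord y u * (xWord x v * (x 0 ^ D * x o)) =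
      if u = v then c u • 1 else 0 := by
    intro u hu
    have := key u hu
    rw [mul_smul_comm, smul_mul_assoc]
    simp only [mul_assoc] at this ⊢
    rw [this]
    split_ifs <;> simp
  rw [Finset.sum_congr rfl this, Finset.sum_ite_eq' c.support v, if_pos hv, smul_smul,
    inv_mul_cancel₀ hcv, one_smul]

end Simple

/-! ### The Leavitt algebra and its representation on functions -/

namespace LeavittAlgebra

variable (K : Type) [Field K] (n : ℕ)

/-- The generators `xᵢ`. -/
noncomputable def x (i : Fin n) : LeavittAlgebra K n :=
  RingQuot.mkAlgHom K (LeavittRel K n) (FreeAlgebra.ι K (Sum.inl i))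

/-- The generators `yᵢ`. -/
noncomputable def y (i : Fin n) : LeavittAlgebra K n :=
  RingQuot.mkAlgHom K (LeavittRel K n) (FreeAlgebra.ι K (Sum.inr i))

theorem isLeavittFamily : IsLeavittFamily (x K n) (y K n) where
  yx i j := by
    rw [x, y, ← map_mul]
    split_ifs with h
    · subst h
      rw [RingQuot.mkAlgHom_rel K (LeavittRel.yx_self i), map_one]
    · rw [RingQuot.mkAlgHom_rel K (LeavittRel.yx_ne h), map_zero]
  sum_xy := by
    simp only [x, y, ← map_mul, ← map_sum]
    rw [RingQuot.mkAlgHom_rel K LeavittRel.xy_sum, map_one]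

theorem adjoin_eq_top : Algebra.adjoin K (Set.range (x K n) ∪ Set.range (y K n)) = ⊤ := by
  have h := congrArg (Subalgebra.map (RingQuot.mkAlgHom K (LeavittRel K n)))
    (FreeAlgebra.adjoin_range_ι K (Fin n ⊕ Fin n))
  rw [Algebra.map_top, (AlgHom.range_eq_top _).2 (RingQuot.mkAlgHom_surjective K _),
    AlgHom.map_adjoin] at h
  rw [← h, ← Set.range_comp, ← Set.Sum.elim_range]
  congr 2
  ext (i | i) <;> rfl

variable {K n}

theorem exists_lift {A : Type*} [Ring A] [Algebra K A] {X Y : Fin n → A}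
    (h : IsLeavittFamily X Y) :
    ∃ φ : LeavittAlgebra K n →ₐ[K] A, (∀ i, φ (x K n i) = X i) ∧ ∀ i, φ (y K n i) = Y i := by
  refine ⟨RingQuot.liftAlgHom K ⟨FreeAlgebra.lift K (Sum.elim X Y), fun a b hab => ?_⟩,
    fun i => ?_, fun i => ?_⟩
  · cases hab with
    | yx_self i => simp [h.yx]
    | yx_ne hij => simp [h.yx, hij]
    | xy_sum => simp [h.sum_xy]
  · simp [x]
  · simp [y]

/-- The action of `xᵢ` on functions on graded infinite sequences. -/
def actX (K : Type) [Field K] {n : ℕ} (i : Fin n) : Module.End K (ℤ × Stream' (Fin n) → K) where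
  toFun f s := if s.2.head = i then f (s.1 - 1, s.2.tail) else 0
  map_add' f g := by ext s; simp only [Pi.add_apply]; split_ifs <;> simp
  map_smul' c f := by ext s; simp

/-- The action of `yᵢ` on functions on graded infinite sequences. -/
def actY (K : Type) [Field K] {n : ℕ} (i : Fin n) : Module.End K (ℤ × Stream' (Fin n) → K) where
  toFun f s := f (s.1 + 1, Stream'.cons i s.2)
  map_add' _ _ := rfl
  map_smul' _ _ := rfl

theorem isLeavittFamily_act : IsLeavittFamily (actX K (n := n)) (actY K) where
  yx i j := by
    ext f s
    by_cases h : i = j <;> simp [actX, actY, h]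
  sum_xy := by
    ext f s
    simp [LinearMap.sum_apply, actX, actY, Finset.sum_apply, Stream'.eta]

theorem yWord_actY_apply (l : List (Fin n)) (f : ℤ × Stream' (Fin n) → K)
    (s : ℤ × Stream' (Fin n)) :
    yWord (actY K) l f s = f (s.1 + l.length, l.reverse ++ₛ s.2) := by
  induction l generalizing s with
  | nil => simp
  | cons i l ih =>
    rw [yWord_cons, Module.End.mul_apply]
    change yWord (actY K) l f (s.1 + 1, Stream'.cons i s.2) = _
    rw [ih]
    simp [add_assoc, add_comm (1 : ℤ), Stream'.append_append_stream, Stream'.cons_append_stream]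

theorem linearIndependent_yWord [NeZero n] : LinearIndependent K (yWord (y K n)) := by
  obtain ⟨φ, -, hφ⟩ := exists_lift (K := K) (isLeavittFamily_act (K := K) (n := n))
  have hφw : ∀ l, φ (yWord (y K n) l) = yWord (actY K) l := by
    intro l
    induction l with
    | nil => simp
    | cons i l ih => rw [yWord_cons, yWord_cons, map_mul, ih, hφ]
  classical
  rw [linearIndependent_iff]
  intro c hc
  ext w
  let s : Stream' (Fin n) := Stream'.const 0
  have h := congrArg (fun a => φ a
    (fun t : ℤ × Stream' (Fin n) => if t = ((w.length : ℤ), w.reverse ++ₛ s) then (1 : K) else 0)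
    (0, s)) hc
  simp only [Finsupp.linearCombination_apply, Finsupp.sum, map_sum, map_smul, hφw, map_zero,
    LinearMap.sum_apply, LinearMap.smul_apply, Finset.sum_apply, Pi.smul_apply,
    yWord_actY_apply, LinearMap.zero_apply, Pi.zero_apply] at h
  have heq : ∀ v : List (Fin n), ((0 : ℤ) + v.length, v.reverse ++ₛ s) =
      ((w.length : ℤ), w.reverse ++ₛ s) ↔ v = w := by
    refine fun v => ⟨fun hv => ?_, fun hv => by simp [hv]⟩
    obtain ⟨h1, h2⟩ := Prod.ext_iff.1 hv
    simp only [zero_add, Nat.cast_inj] at h1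
    have h3 := congrArg (Stream'.take v.length) h2
    have h4 : ∀ u : List (Fin n), Stream'.take u.length (u.reverse ++ₛ s) = u.reverse := fun u => by
      have := Stream'.take_append_of_le_length (x := u.reverse) (a := s) (n := u.length) (by simp)
      rw [this, List.take_of_length_le (by simp)]
    simp only at h3
    rw [h4, h1, h4] at h3
    exact List.reverse_injective h3
  simp only [heq] at h
  simpa [Finsupp.sum] using h

end LeavittAlgebra

/-! ### Submodules of finite codimension in free modules over a free algebra -/

section Shift

variable {K : Type*} [Field K] {ι P Q : Type*}

/-- Left multiplication by the letter `i` on the free module with basis `P` over the free algebra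
on `ι`. -/
noncomputable def shift (K : Type*) [Field K] {ι : Type*} (P : Type*) (i : ι) :
    (P × List ι →₀ K) →ₗ[K] (P × List ι →₀ K) :=
  Finsupp.lmapDomain K K (Prod.map id (List.cons i))

@[simp] theorem shift_single (i : ι) (p : P) (l : List ι) (c : K) :
    shift K P i (Finsupp.single (p, l) c) = Finsupp.single (p, i :: l) c := by
  simp [shift, Finsupp.lmapDomain_apply]

theorem prodMap_cons_injective (i : ι) :
    Function.Injective (Prod.map (id : P → P) (List.cons i)) :=
  Function.injective_id.prodMap (List.cons_injective)

theorem shift_apply_cons [DecidableEq ι] (i j : ι) (f : P × List ι →₀ K) (p : P) (l : List ι) :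
    shift K P i f (p, j :: l) = if i = j then f (p, l) else 0 := by
  split_ifs with h
  · subst h
    exact Finsupp.mapDomain_apply (prodMap_cons_injective i) f (p, l)
  · refine Finsupp.mapDomain_of_notMem_range _ _ ?_
    rintro ⟨⟨q, l'⟩, hq⟩
    simp only [Prod.map_apply, Prod.mk.injEq, List.cons.injEq] at hq
    exact h hq.2.1

@[simp] theorem shift_apply_nil (i : ι) (f : P × List ι →₀ K) (p : P) :
    shift K P i f (p, []) = 0 := by
  refine Finsupp.mapDomain_of_notMem_range _ _ ?_
  rintro ⟨⟨q, l⟩, hq⟩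
  simp at hq

/-- The part of an element that starts with the letter `i`, with that letter removed. -/
noncomputable def unshift (K : Type*) [Field K] {ι : Type*} (P : Type*) (i : ι) :
    (P × List ι →₀ K) →ₗ[K] (P × List ι →₀ K) :=
  Finsupp.lcomapDomain (Prod.map id (List.cons i)) (prodMap_cons_injective i)

@[simp] theorem unshift_apply (i : ι) (f : P × List ι →₀ K) (p : P) (l : List ι) :
    unshift K P i f (p, l) = f (p, i :: l) := rfl

theorem unshift_shift [DecidableEq ι] (i j : ι) (f : P × List ι →₀ K) :
    unshift K P j (shift K P i f) = if i = j then f else 0 := by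
  ext ⟨p, l⟩
  rw [unshift_apply, shift_apply_cons]
  split_ifs <;> rfl

@[simp] theorem unshift_single_nil (i : ι) (p : P) (c : K) :
    unshift K P i (Finsupp.single (p, []) c) = 0 := by
  ext ⟨q, l⟩
  simp

/-- The submodule generated by all shifts of elements of `M`. -/
noncomputable def shiftSpan (M : Submodule K (P × List ι →₀ K)) :
    Submodule K (P × List ι →₀ K) := ⨆ i, M.map (shift K P i)

theorem map_shiftSpan {φ : (Q × List ι →₀ K) →ₗ[K] (P × List ι →₀ K)}
    (hφ : ∀ i f, φ (shift K Q i f) = shift K P i (φ f)) (M : Submodule K (Q × List ι →₀ K)) :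
    (shiftSpan M).map φ = shiftSpan (M.map φ) := by
  rw [shiftSpan, Submodule.map_iSup, shiftSpan]
  congr 1
  ext1 i
  rw [← Submodule.map_comp, ← Submodule.map_comp]
  congr 1
  ext1 ⟨p, l⟩
  ext1
  simpa using hφ i (Finsupp.single (p, l) 1)

/-- Separates an element into its constant term and, for each letter, its part starting with that
letter, the latter modulo `M`. -/
noncomputable def splitMap (M : Submodule K (P × List ι →₀ K)) :
    (P × List ι →₀ K) →ₗ[K] (P → K) × (ι → (P × List ι →₀ K) ⧸ M) :=
  (LinearMap.pi fun p => Finsupp.lapply (p, [])).prod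
    (LinearMap.pi fun i => M.mkQ ∘ₗ unshift K P i)

theorem splitMap_apply (M : Submodule K (P × List ι →₀ K)) (f : P × List ι →₀ K) :
    splitMap M f = (fun p => f (p, []), fun i => M.mkQ (unshift K P i f)) := rfl

variable [DecidableEq ι]

theorem splitMap_shift (M : Submodule K (P × List ι →₀ K)) (i : ι) (f : P × List ι →₀ K) :
    splitMap M (shift K P i f) = (0, Pi.single i (M.mkQ f)) := by
  rw [splitMap_apply]
  refine Prod.ext (by ext; simp) ?_
  ext1 j
  change M.mkQ (unshift K P j (shift K P i f)) = _
  rw [unshift_shift]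
  by_cases h : i = j
  · subst h; simp
  · simp [h]

theorem splitMap_nil (M : Submodule K (P × List ι →₀ K)) [DecidableEq P] (p : P) (c : K) :
    splitMap M (Finsupp.single (p, []) c) = (Pi.single p c, 0) := by
  rw [splitMap_apply]
  refine Prod.ext ?_ (by ext1; simp)
  ext q
  simp [Finsupp.single_apply, Pi.single_apply, eq_comm]

variable [Fintype ι] [Fintype P] [Fintype Q]

theorem eq_sum_split (f : P × List ι →₀ K) :
    f = ∑ p, Finsupp.single (p, []) (f (p, [])) + ∑ i, shift K P i (unshift K P i f) := by
  classical
  ext ⟨q, l⟩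
  rw [Finsupp.add_apply, Finsupp.finsetSum_apply, Finsupp.finsetSum_apply]
  cases l with
  | nil => simp [Finsupp.single_apply]
  | cons j l => simp [shift_apply_cons]

theorem ker_splitMap (M : Submodule K (P × List ι →₀ K)) :
    LinearMap.ker (splitMap M) = shiftSpan M := by
  apply le_antisymm
  · intro f hf
    rw [LinearMap.mem_ker] at hf
    have h1 : ∀ p, f (p, []) = 0 := fun p => congrFun (congrArg Prod.fst hf) p
    rw [eq_sum_split f]
    refine add_mem (by simp [h1]) (Submodule.sum_mem _ fun i _ => ?_)
    refine Submodule.mem_iSup_of_mem i (Submodule.mem_map_of_mem ?_)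
    have h2 := congrFun (congrArg Prod.snd hf) i
    exact (Submodule.Quotient.mk_eq_zero M).1 h2
  · refine iSup_le fun i => ?_
    rintro _ ⟨f, hf, rfl⟩
    rw [LinearMap.mem_ker, splitMap_shift, Submodule.mkQ_apply,
      (Submodule.Quotient.mk_eq_zero M).2 hf, Pi.single_zero]
    rfl

theorem splitMap_surjective (M : Submodule K (P × List ι →₀ K)) :
    Function.Surjective (splitMap M) := by
  classical
  rintro ⟨a, b⟩
  choose g hg using fun i => M.mkQ_surjective (b i)
  refine ⟨∑ p, Finsupp.single (p, []) (a p) + ∑ i, shift K P i (g i), ?_⟩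
  simp only [map_add, map_sum, splitMap_nil, splitMap_shift, hg]
  refine Prod.ext ?_ ?_
  · simp [Prod.fst_sum, Finset.univ_sum_single]
  · simp [Prod.snd_sum, Finset.univ_sum_single]

/-- The quotient by the shifts of `M`. -/
noncomputable def quotShiftSpanEquiv (M : Submodule K (P × List ι →₀ K)) :
    ((P × List ι →₀ K) ⧸ shiftSpan M) ≃ₗ[K] (P → K) × (ι → (P × List ι →₀ K) ⧸ M) :=
  (Submodule.quotEquivOfEq _ _ (ker_splitMap M).symm).trans
    ((splitMap M).quotKerEquivOfSurjective (splitMap_surjective M))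

/-- The Schreier-Lewin formula. -/
theorem card_add_finrank_eq {φ : (Q × List ι →₀ K) →ₗ[K] (P × List ι →₀ K)}
    (hinj : Function.Injective φ) (hφ : ∀ i f, φ (shift K Q i f) = shift K P i (φ f))
    [FiniteDimensional K ((P × List ι →₀ K) ⧸ LinearMap.range φ)] :
    Fintype.card Q + Module.finrank K ((P × List ι →₀ K) ⧸ LinearMap.range φ) =
      Fintype.card P +
        Fintype.card ι * Module.finrank K ((P × List ι →₀ K) ⧸ LinearMap.range φ) := by
  set M := LinearMap.range φ with hM
  set N := shiftSpan (⊤ : Submodule K (Q × List ι →₀ K))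
  have hNM : N.map φ = shiftSpan M := by rw [map_shiftSpan hφ, Submodule.map_top]
  have e := quotShiftSpanEquiv M
  have : FiniteDimensional K ((P × List ι →₀ K) ⧸ shiftSpan M) :=
    Module.Finite.equiv e.symm
  have h1 : Module.finrank K ((P × List ι →₀ K) ⧸ shiftSpan M) =
      Fintype.card P + Fintype.card ι * Module.finrank K ((P × List ι →₀ K) ⧸ M) := by
    have : Module.Free K ((P × List ι →₀ K) ⧸ M) := Module.Free.of_divisionRing _ _
    rw [e.finrank_eq, Module.finrank_prod, Module.finrank_fintype_fun_eq_card,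
      Module.finrank_pi_fintype]
    simp
  have h2 : Module.finrank K ((Q × List ι →₀ K) ⧸ N) = Fintype.card Q := by
    rw [(quotShiftSpanEquiv _).finrank_eq, Module.finrank_prod,
      Module.finrank_fintype_fun_eq_card, Module.finrank_pi_fintype]
    simp [Module.finrank_zero_of_subsingleton]
  let ψ : ((Q × List ι →₀ K) ⧸ N) →ₗ[K] ((P × List ι →₀ K) ⧸ shiftSpan M) :=
    N.mapQ (shiftSpan M) φ (by rw [← hNM]; exact Submodule.le_comap_map φ N)
  have hψ : Function.Injective ψ := by
    rw [← LinearMap.ker_eq_bot, Submodule.ker_mapQ, ← hNM, Submodule.comap_map_eq_of_injective hinj,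
      Submodule.mkQ_map_self]
  have hle : shiftSpan M ≤ M := by rw [← hNM]; exact LinearMap.map_le_range
  have hrange : LinearMap.range ψ = M.map (shiftSpan M).mkQ := by
    rw [Submodule.range_mapQ]
  have h3 := (LinearMap.range ψ).finrank_quotient_add_finrank
  rw [LinearMap.finrank_range_of_inj hψ, h1, h2, hrange,
    (Submodule.quotientQuotientEquivQuotient _ _ hle).finrank_eq] at h3
  rw [← h3, add_comm]

end Shift

/-! ### The rank of a free module modulo `m` -/

section Rank

variable {K R ι P Q : Type*} [Field K] [Ring R] [Algebra K R]

theorem exists_vecMul_mem [Fintype ι] [DecidableEq ι] [Fintype P] [Finite Q]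
    {x y : ι → R}
    (h : IsLeavittFamily x y) (hgen : Algebra.adjoin K (Set.range x ∪ Set.range y) = ⊤)
    (A : Matrix P Q R) (T : ℕ) :
    ∃ N, ∀ v : P → R, (∀ p, v p ∈ wordSpan K y N) → ∀ q, (v ᵥ* A) q ∈ wordSpan K y T := by
  have := Fintype.ofFinite Q
  choose N hN using fun s : P × Q => h.exists_wordSpan_mul_mem hgen (A s.1 s.2) T
  refine ⟨Finset.univ.sup N, fun v hv q => Submodule.sum_mem _ fun p _ => ?_⟩
  exact hN (p, q) _ (wordSpan_anti y (Finset.le_sup (Finset.mem_univ _)) (hv p))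

theorem finite_quotient_of_single_mem [Finite ι] [Finite P] {M : Submodule K (P × List ι →₀ K)}
    (T : ℕ) (hM : ∀ p (l : List ι), T ≤ l.length → Finsupp.single (p, l) 1 ∈ M) :
    Module.Finite K ((P × List ι →₀ K) ⧸ M) := by
  let S : Set (P × List ι) := Set.univ ×ˢ {l | l.length < T}
  have hS : S.Finite := Set.finite_univ.prod (List.finite_length_lt ι T)
  refine ⟨(Submodule.fg_def).2 ⟨(fun s => M.mkQ (Finsupp.single s 1)) '' S, hS.image _, ?_⟩⟩
  rw [eq_top_iff, ← M.range_mkQ]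
  rintro _ ⟨f, rfl⟩
  induction f using Finsupp.induction_linear with
  | zero => simp
  | add f g hf hg => rw [map_add]; exact add_mem hf hg
  | single s c =>
    rw [← mul_one c, ← Finsupp.smul_single', map_smul]
    refine Submodule.smul_mem _ _ ?_
    by_cases hs : s.2.length < T
    · exact Submodule.subset_span ⟨s, ⟨trivial, hs⟩, rfl⟩
    · rw [Submodule.mkQ_apply, (Submodule.Quotient.mk_eq_zero M).2 (hM s.1 s.2 (by omega))]
      exact zero_mem _

/-- The embedding into `P → R` of the free module over the free algebra generated by the vectors
`Pi.single p (yWord y u)` with `u` a word of length `N`. -/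
noncomputable def wordVec (K : Type*) [Field K] [Algebra K R] (P : Type*) [DecidableEq P]
    (y : ι → R) (N : ℕ) : ((P × List.Vector ι N) × List ι →₀ K) →ₗ[K] (P → R) :=
  Finsupp.linearCombination K fun s => Pi.single s.1.1 (yWord y (s.2 ++ s.1.2.1))

variable [DecidableEq P] [DecidableEq Q] {x y : ι → R}

theorem wordVec_single (N : ℕ) (s : (P × List.Vector ι N) × List ι) :
    wordVec K P y N (Finsupp.single s 1) = Pi.single s.1.1 (yWord y (s.2 ++ s.1.2.1)) := by
  simp [wordVec]

theorem wordVec_injective [Finite P] (hy : LinearIndependent K (yWord y)) (N : ℕ) :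
    Function.Injective (wordVec K P y N) := by
  have h := Pi.linearIndependent_single (R := K) (fun (_ : P) (l : List ι) => yWord y l)
    fun _ => hy
  refine h.comp (fun s : (P × List.Vector ι N) × List ι => ⟨s.1.1, s.2 ++ s.1.2.1⟩) ?_
  rintro ⟨⟨p, u⟩, w⟩ ⟨⟨p', u'⟩, w'⟩ hs
  simp only [Sigma.mk.injEq, heq_eq_eq] at hs
  obtain ⟨rfl, hs⟩ := hs
  obtain ⟨rfl, hu⟩ := List.append_inj' hs (by rw [u.2, u'.2])
  rw [Subtype.ext hu]

theorem wordVec_shift (N : ℕ) (i : ι) (f : (P × List.Vector ι N) × List ι →₀ K) :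
    wordVec K P y N (shift K _ i f) = y i • wordVec K P y N f := by
  induction f using Finsupp.induction_linear with
  | zero => simp
  | add f g hf hg => rw [map_add, map_add, hf, hg, map_add, smul_add]
  | single s c =>
    obtain ⟨s, l⟩ := s
    rw [shift_single, wordVec, Finsupp.linearCombination_single, Finsupp.linearCombination_single,
      smul_comm]
    simp [← Pi.single_smul]

theorem mem_range_wordVec [Fintype P] {N : ℕ} {v : P → R} :
    v ∈ LinearMap.range (wordVec K P y N) ↔ ∀ p, v p ∈ wordSpan K y N := by
  constructor
  · rintro ⟨f, rfl⟩ p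
    induction f using Finsupp.induction_linear with
    | zero => simp
    | add f g hf hg => rw [map_add]; exact add_mem hf hg
    | single s c =>
      rw [wordVec, Finsupp.linearCombination_single]
      refine Submodule.smul_mem _ _ ?_
      by_cases h : p = s.1.1
      · subst h
        rw [Pi.single_eq_same]
        exact yWord_mem_wordSpan (by simp)
      · rw [Pi.single_eq_of_ne h]
        exact zero_mem _
  · intro h
    rw [← Finset.univ_sum_single v]
    refine Submodule.sum_mem _ fun p _ => ?_
    have : wordSpan K y N ≤
        (LinearMap.range (wordVec K P y N)).comap (LinearMap.single K (fun _ => R) p) := by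
      refine Submodule.span_le.2 ?_
      rintro _ ⟨l, hl, rfl⟩
      refine ⟨Finsupp.single ((p, ⟨l.drop (l.length - N), ?_⟩), l.take (l.length - N)) 1, ?_⟩
      · have : N ≤ l.length := hl
        simp; omega
      · rw [wordVec_single]
        simp
    exact this (h p)

theorem RectIso.card_modEq {p q m : ℕ} {x y : Fin (m + 1) → R} (h : IsLeavittFamily x y)
    (hgen : Algebra.adjoin K (Set.range x ∪ Set.range y) = ⊤)
    (hy : LinearIndependent K (yWord y)) (hpq : RectIso R (Fin p) (Fin q)) : p ≡ q [MOD m] := by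
  obtain ⟨A, B, hAB, hBA⟩ := hpq
  obtain ⟨N, hN⟩ := exists_vecMul_mem (K := K) h hgen A 0
  obtain ⟨T, hT⟩ := exists_vecMul_mem (K := K) h hgen B N
  let mulA : (Fin p → R) →ₗ[K] (Fin q → R) := A.vecMulLinear.restrictScalars K
  have hmulA : ∀ v, mulA v = v ᵥ* A := fun _ => rfl
  have hinj := wordVec_injective (K := K) (P := Fin q) hy 0
  let e := LinearEquiv.ofInjective (wordVec K (Fin q) y 0) hinj
  let φ : ((Fin p × List.Vector (Fin (m + 1)) N) × List (Fin (m + 1)) →₀ K) →ₗ[K]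
      ((Fin q × List.Vector (Fin (m + 1)) 0) × List (Fin (m + 1)) →₀ K) :=
    e.symm ∘ₗ (mulA ∘ₗ wordVec K (Fin p) y N).codRestrict _ fun f =>
      mem_range_wordVec.2 (hN _ (mem_range_wordVec.1 ⟨f, rfl⟩))
  have hφ : ∀ f, wordVec K (Fin q) y 0 (φ f) = wordVec K (Fin p) y N f ᵥ* A := fun f =>
    congrArg Subtype.val (e.apply_symm_apply _)
  have hφinj : Function.Injective φ := by
    intro f g hfg
    have := congrArg (wordVec K (Fin q) y 0) hfg
    rw [hφ, hφ] at this
    have := congrArg (· ᵥ* B) this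
    simp only [Matrix.vecMul_vecMul, hAB, Matrix.vecMul_one] at this
    exact wordVec_injective hy N this
  have hφshift : ∀ i f, φ (shift K _ i f) = shift K _ i (φ f) := by
    intro i f
    apply hinj
    rw [hφ, wordVec_shift, wordVec_shift, hφ, Matrix.smul_vecMul]
  have hfin : FiniteDimensional K (_ ⧸ LinearMap.range φ) := by
    refine finite_quotient_of_single_mem T fun s l hl => ?_
    have hmem : ∀ j, (wordVec K (Fin q) y 0 (Finsupp.single (s, l) 1)) j ∈ wordSpan K y T := by
      intro j
      rw [wordVec_single]
      by_cases hj : j = s.1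
      · subst hj
        rw [Pi.single_eq_same]
        exact yWord_mem_wordSpan (by simp; omega)
      · rw [Pi.single_eq_of_ne hj]
        exact zero_mem _
    obtain ⟨f, hf⟩ := mem_range_wordVec.2 (hT _ hmem)
    refine ⟨f, hinj ?_⟩
    rw [hφ, hf, Matrix.vecMul_vecMul, hBA, Matrix.vecMul_one]
  have key := card_add_finrank_eq hφinj hφshift
  simp only [Fintype.card_prod, Fintype.card_fin, card_vector, pow_zero, mul_one] at key
  set k := Module.finrank K (_ ⧸ LinearMap.range φ)
  have h1 : (m + 1) ≡ 1 [MOD m] := by simp [Nat.ModEq]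
  have h2 := ((h1.pow N).mul_left p).add_right k
  rw [key] at h2
  have h3 := (h1.mul_right k).add_left q
  have h4 := h2.symm.trans h3
  simp only [one_pow, mul_one, one_mul] at h4
  exact Nat.ModEq.add_right_cancel' k h4

end Rank

/-! ### Necessity of the condition on greatest common divisors -/

theorem LeavittAlgebra.gcd_dvd_of_algEquiv {K : Type} [Field K] {m d d' : ℕ} (hm : 0 < m)
    (hd : 0 < d)
    (e : Matrix (Fin d) (Fin d) (LeavittAlgebra K (m + 1)) ≃ₐ[K]
      Matrix (Fin d') (Fin d') (LeavittAlgebra K (m + 1))) : Nat.gcd d m ∣ d' := by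
  obtain ⟨u, hu⟩ := Nat.gcd_dvd_left d m
  obtain ⟨k, hk⟩ := Nat.gcd_dvd_right d m
  set g := Nat.gcd d m
  have h := RectIso.fin_add (isLeavittFamily K (m + 1)) hd u
  have hcard : d + u * m = (k + 1) * d := by rw [hk, hu]; ring
  obtain ⟨X, Y, hXY⟩ := (h.trans (RectIso.of_equiv
    ((finCongr hcard).trans finProdFinEquiv.symm))).exists_isLeavittFamily
  have h' := (RectIso.of_isLeavittFamily (hXY.map e)).trans
    (RectIso.of_equiv finProdFinEquiv)
  have h1 := h'.card_modEq (isLeavittFamily K (m + 1)) (adjoin_eq_top K (m + 1))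
    linearIndependent_yWord
  have h2 : 0 + d' ≡ k * d' + d' [MOD m] := by
    rw [zero_add, ← Nat.succ_mul]; exact h1
  have h3 : m ∣ k * d' := (Nat.modEq_zero_iff_dvd).1 (Nat.ModEq.add_right_cancel' d' h2).symm
  have hk0 : 0 < k := Nat.pos_of_ne_zero fun h0 => by simp [h0] at hk; omega
  rw [hk, mul_comm g] at h3
  exact Nat.dvd_of_mul_dvd_mul_left hk0 h3

/-! ### Leavitt families of matrices with monomial columns -/

section Col

variable {R κ ι : Type*} [Ring R] [DecidableEq ι]

/-- The matrices whose column `j` has the single entry `p (i, j)`, in row `t (i, j)`. -/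
def colX (t : κ × ι → ι) (p : κ × ι → R) (i : κ) : Matrix ι ι R :=
  Matrix.of fun a j => if t (i, j) = a then p (i, j) else 0

/-- The matrices whose row `j` has the single entry `q (i, j)`, in column `t (i, j)`. -/
def colY (t : κ × ι → ι) (q : κ × ι → R) (i : κ) : Matrix ι ι R :=
  Matrix.of fun j a => if t (i, j) = a then q (i, j) else 0

variable [Fintype ι] {t : κ × ι → ι} {p q : κ × ι → R}

theorem single_mul_colX_mul_single (s : κ × ι) :
    Matrix.single (t s) (t s) 1 * colX t p s.1 * Matrix.single s.2 s.2 1 =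
      Matrix.single (t s) s.2 (p s) := by
  simp [colX]

theorem single_mul_colY_mul_single (s : κ × ι) :
    Matrix.single s.2 s.2 1 * colY t q s.1 * Matrix.single (t s) (t s) 1 =
      Matrix.single s.2 (t s) (q s) := by
  simp [colY]

variable [Fintype κ]

theorem sum_colX_mul_diagonal_mul_colY
    (hpq : ∀ a, ∑ s, (if t s = a then p s * q s else 0) = 1)
    (b : κ → ι → Prop) [∀ i, DecidablePred (b i)] (c : ι → Prop) [DecidablePred c]
    (hbc : ∀ s : κ × ι, b s.1 s.2 ↔ c (t s)) :
    ∑ i, colX t p i * Matrix.diagonal (fun j => if b i j then 1 else 0) * colY t q i =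
      Matrix.diagonal fun a => if c a then 1 else 0 := by
  ext a a'
  have h1 : (∑ i, colX t p i * Matrix.diagonal (fun j => if b i j then 1 else 0) *
      colY t q i : Matrix ι ι R) a a' =
      ∑ s : κ × ι, if t s = a then (if a = a' ∧ c a then p s * q s else 0) else 0 := by
    rw [Matrix.sum_apply, Fintype.sum_prod_type]
    refine Finset.sum_congr rfl fun i _ => ?_
    rw [Matrix.mul_apply]
    refine Finset.sum_congr rfl fun j _ => ?_
    rw [Matrix.mul_diagonal]
    have := hbc (i, j)
    simp only [colX, colY, Matrix.of_apply]
    by_cases ht : t (i, j) = a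
    · by_cases haa : a = a'
      · by_cases hc : c a <;> simp_all
      · simp [ht, haa]
    · simp [ht]
  rw [h1]
  by_cases haa : a = a' ∧ c a
  · simp only [if_pos haa]
    rw [← haa.1, Matrix.diagonal_apply_eq, if_pos haa.2, ← hpq a]
  · simp only [haa, if_false]
    rw [Matrix.diagonal_apply]
    split_ifs <;> simp_all

theorem isLeavittFamily_col [DecidableEq κ]
    (hqp : ∀ s s', t s = t s' → q s * p s' = if s = s' then 1 else 0)
    (hpq : ∀ a, ∑ s, (if t s = a then p s * q s else 0) = 1) :
    IsLeavittFamily (colX t p) (colY t q) where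
  yx i i' := by
    ext j j'
    have h1 : (colY t q i * colX t p i') j j' =
        if t (i, j) = t (i', j') then q (i, j) * p (i', j') else 0 := by
      rw [Matrix.mul_apply, Finset.sum_eq_single (t (i, j))]
      · simp [colX, colY, eq_comm]
      · intro a _ ha
        simp [colY, ha.symm]
      · simp
    rw [h1]
    by_cases ht : t (i, j) = t (i', j')
    · rw [if_pos ht, hqp _ _ ht]
      by_cases hi : i = i' <;> simp [hi, Matrix.one_apply]
    · rw [if_neg ht]
      by_cases hi : i = i'
      · subst hi
        rw [if_pos rfl, Matrix.one_apply_ne]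
        rintro rfl
        exact ht rfl
      · simp [hi]
  sum_xy := by
    simpa using sum_colX_mul_diagonal_mul_colY hpq (fun _ _ => True) (fun _ => True) (by simp)

end Col

/-! ### Combinatorics of residues -/

theorem Nat.Coprime.exists_add_mul_mod {d m : ℕ} (hd : 1 < d) (h : Nat.Coprime d m) (l r : ℕ) :
    ∃ T, (l + T * m) % d = r % d := by
  obtain ⟨v, -, hv⟩ := Nat.exists_mul_mod_eq_one_of_coprime h.symm hd
  refine ⟨v * (r + (d - 1) * l), ?_⟩
  have h1 : m * v ≡ 1 [MOD d] := by rw [Nat.ModEq, hv, Nat.mod_eq_of_lt hd]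
  have h2 := (h1.mul_right (r + (d - 1) * l)).add_left l
  obtain ⟨d, rfl⟩ : ∃ c, d = c + 1 := ⟨d - 1, by omega⟩
  simp only [Nat.add_sub_cancel] at h2 ⊢
  rw [show l + v * (r + d * l) * m = l + m * v * (r + d * l) by ring]
  refine Eq.trans h2 ?_
  rw [show l + 1 * (r + d * l) = r + (d + 1) * l by ring, Nat.add_mul_mod_self_left]

/-- The residue class `N` has colour `true` when `N * v` modulo `d` lies in the last `v` residues. -/
def colour (d v N : ℕ) : Bool := decide (d ≤ N * v % d + v)

theorem colour_mod (d v N : ℕ) : colour d v (N % d) = colour d v N := by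
  simp [colour, Nat.mod_mul_mod]

theorem sum_colour {d v : ℕ} (hv : v < d) (X : ℕ) :
    (∑ N ∈ Finset.range X, if colour d v N = true then 1 else 0) = X * v / d := by
  have hd : 0 < d := by omega
  induction X with
  | zero => simp
  | succ X ih =>
    rw [Finset.sum_range_succ, ih, Nat.succ_mul, Nat.add_div hd, Nat.div_eq_of_lt hv,
      Nat.mod_eq_of_lt hv]
    simp [colour]

section Colour

variable {D m v w : ℕ}

theorem colour_zero (hv : v < D + 2) : colour (D + 2) v 0 = false := by
  simp [colour]; omega

theorem colour_last (hv0 : 0 < v) (hv : v < D + 2) : colour (D + 2) v (D + 1) = true := by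
  obtain ⟨v, rfl⟩ : ∃ c, v = c + 1 := ⟨v - 1, by omega⟩
  have h : (D + 1) * (v + 1) = (D + 1 - v) + (D + 2) * v := by
    zify [show v ≤ D + 1 by omega]; ring
  rw [colour, h, Nat.add_mul_mod_self_left, Nat.mod_eq_of_lt (by omega), decide_eq_true_eq]
  omega

theorem colour_add (hv : v < D + 2) (hvw : m * v + 1 = (D + 2) * w) {l : ℕ} (h1 : 1 ≤ l)
    (h2 : l ≤ D) : colour (D + 2) v (l + m) = colour (D + 2) v l := by
  have hdvd : ∀ k, 1 ≤ k → k < D + 2 → k * v % (D + 2) ≠ 0 := by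
    intro k hk hk' h0
    have h3 : D + 2 ∣ k * v * m + k := ⟨k * w, by
      rw [show k * v * m + k = k * (m * v + 1) by ring, hvw]; ring⟩
    have := (Nat.dvd_add_right ((Nat.dvd_of_mod_eq_zero h0).mul_right m)).1 h3
    exact absurd (Nat.le_of_dvd hk this) (by omega)
  have hl := hdvd l h1 (by omega)
  have hl' := hdvd (l + 1) (by omega) (by omega)
  have hr := Nat.mod_lt (l * v) (show 0 < D + 2 by omega)
  have hmod : (l + m) * v % (D + 2) = l * v % (D + 2) - 1 := by
    have h3 : (l + m) * v + 1 = (l * v % (D + 2) - 1 + 1) + (D + 2) * (l * v / (D + 2) + w) := by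
      rw [Nat.sub_add_cancel (by omega), mul_add, ← add_assoc, Nat.mod_add_div, ← hvw]; ring
    have h4 : (l + m) * v = (l * v % (D + 2) - 1) + (D + 2) * (l * v / (D + 2) + w) := by omega
    rw [h4, Nat.add_mul_mod_self_left, Nat.mod_eq_of_lt (by omega)]
  have hne : l * v % (D + 2) + v ≠ D + 2 := by
    intro h3
    apply hl'
    rw [Nat.succ_mul, ← Nat.mod_add_mod, h3, Nat.mod_self]
  simp only [colour, hmod, decide_eq_decide]
  omega

theorem card_colour_leaves (hv0 : 0 < v) (hv : v < D + 2) (hvw : m * v + 1 = (D + 2) * w) :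
    Fintype.card {u : Fin ((D + 1) * m + 1) // colour (D + 2) v (m + 1 + D + u) = true} =
      (D + 1) * w := by
  rw [Fintype.card_subtype, Finset.card_filter, Fin.sum_univ_eq_sum_range
    (fun u => if colour (D + 2) v (m + 1 + D + u) = true then 1 else 0)]
  have h := Finset.sum_range_add (fun N => if colour (D + 2) v N = true then 1 else 0)
    (m + 1 + D) ((D + 1) * m + 1)
  rw [sum_colour hv, sum_colour hv,
    show (m + 1 + D + ((D + 1) * m + 1)) * v = (D + 2) * ((m + 1) * v) by ring,
    Nat.mul_div_cancel_left _ (by omega)] at h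
  obtain ⟨v, rfl⟩ : ∃ c, v = c + 1 := ⟨v - 1, by omega⟩
  have h1 : (m + 1 + D) * (v + 1) = (D - v) + (D + 2) * (w + v) := by
    zify [show v ≤ D by omega] at hvw ⊢
    linear_combination hvw
  rw [h1, Nat.add_mul_div_left _ _ (by omega), Nat.div_eq_of_lt (by omega)] at h
  have h2 : (m + 1) * (v + 1) = (D + 1) * w + w + v := by linarith
  omega

/-- The colour of a leaf of the tree splitting `r` times the first leaf. -/
def leafColour (g : ℕ → Bool) {r m : ℕ} : Option (Fin r × Fin m) → Bool
  | none => false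
  | some s => g (s.2 + 1)

theorem card_leafColour (hv : v < D + 2) (hvw : m * v + 1 = (D + 2) * w) :
    Fintype.card {u : Option (Fin (D + 1) × Fin m) // leafColour (colour (D + 2) v) u = true} =
      (D + 1) * w := by
  have h := sum_colour hv (m + 1)
  rw [Finset.sum_range_succ', colour_zero hv, Nat.succ_mul] at h
  have h1 : m * v + v = (v - 1) + (D + 2) * w ∨ v = 0 := by omega
  have h2 : (m * v + v) / (D + 2) = w := by
    rcases h1 with h1 | rfl
    · rw [h1, Nat.add_mul_div_left _ _ (by omega), Nat.div_eq_of_lt (by omega), zero_add]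
    · exact absurd hvw (by
        rw [mul_zero]
        intro h0
        have := Nat.eq_one_of_mul_eq_one_right h0.symm
        omega)
  rw [h2] at h
  rw [Fintype.card_subtype, Finset.card_filter, Fintype.sum_option, Fintype.sum_prod_type]
  change 0 + ∑ _ : Fin (D + 1), ∑ k : Fin m,
    (if colour (D + 2) v (k + 1) = true then 1 else 0) = _
  rw [Fin.sum_univ_eq_sum_range (fun u => if colour (D + 2) v (u + 1) = true then 1 else 0)]
  simp only [Bool.false_eq_true, if_false, add_zero] at h
  rw [h]
  simp

end Colour

theorem exists_equiv_of_card_eq {α β : Type*} [Fintype α] [Fintype β] (f : α → Bool)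
    (g : β → Bool) (h : Fintype.card α = Fintype.card β)
    (h' : Fintype.card {a // f a = true} = Fintype.card {b // g b = true}) :
    ∃ e : α ≃ β, ∀ a, g (e a) = f a := by
  have hf : Fintype.card {a // f a = false} = Fintype.card {b // g b = false} := by
    have h1 := Fintype.card_subtype_compl (fun a => f a = true)
    have h2 := Fintype.card_subtype_compl (fun b => g b = true)
    simp only [Bool.not_eq_true] at h1 h2
    rw [h1, h2, h, h']
  have e : ∀ c, {a // f a = c} ≃ {b // g b = c} := fun c =>
    Fintype.equivOfCardEq (by cases c <;> assumption)
  exact ⟨Equiv.ofFiberEquiv e, fun a => Equiv.ofFiberEquiv_map e a⟩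

/-- The positions in a Leavitt family of `m + 1` matrices of size `D + 2`, numbered from left to
right, are distributed over `D + 2` trees: one with the leaves `x k`, then `D` trivial ones, then
one with `(D + 1) * m + 1` leaves. -/
theorem exists_partition {D m : ℕ} (h : Nat.Coprime (D + 2) m) :
    ∃ (g : ℕ → Bool)
      (e : Fin (m + 1) × Fin (D + 2) ≃ Fin (m + 1) ⊕ Fin D ⊕ Option (Fin (D + 1) × Fin m)),
      (∀ N, g (N % (D + 2)) = g N) ∧ g 0 = false ∧ g (D + 1) = true ∧
      (∀ l, 1 ≤ l → l ≤ D → g (l + m) = g l) ∧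
      (∀ s k, e s = Sum.inl k → s.1 * (D + 2) + s.2 = (k : ℕ)) ∧
      (∀ s a, e s = Sum.inr (Sum.inl a) → s.1 * (D + 2) + s.2 = (m + 1 + a : ℕ)) ∧
      ∀ s u, e s = Sum.inr (Sum.inr u) →
        (m + D + 1 : ℕ) ≤ s.1 * (D + 2) + s.2 ∧ g s.2 = leafColour g u := by
  obtain ⟨v, w, hv0, hv, hvw⟩ : ∃ v w, 0 < v ∧ v < D + 2 ∧ m * v + 1 = (D + 2) * w := by
    obtain ⟨T, hT⟩ := h.exists_add_mul_mod (by omega) 1 0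
    have hT' : (m * (T % (D + 2)) + 1) % (D + 2) = 0 := by
      rw [← Nat.mod_add_mod, Nat.mul_mod_mod, Nat.mod_add_mod, add_comm, mul_comm, hT,
        Nat.zero_mod]
    obtain ⟨w, hw⟩ := Nat.dvd_of_mod_eq_zero hT'
    refine ⟨T % (D + 2), w, Nat.pos_of_ne_zero fun h0 => ?_, Nat.mod_lt _ (by omega), hw⟩
    rw [h0, mul_zero, zero_add, Nat.mod_eq_of_lt (by omega)] at hT'
    exact one_ne_zero hT'
  obtain ⟨σ, hσ⟩ := exists_equiv_of_card_eq
    (fun u : Fin ((D + 1) * m + 1) => colour (D + 2) v (m + 1 + D + u))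
    (leafColour (r := D + 1) (m := m) (colour (D + 2) v)) (by simp)
    (by rw [card_colour_leaves hv0 hv hvw, card_leafColour hv hvw])
  have hcard : (m + 1) * (D + 2) = (m + 1) + (D + ((D + 1) * m + 1)) := by ring
  let e₁ : Fin (m + 1) × Fin (D + 2) ≃ Fin (m + 1) ⊕ Fin D ⊕ Fin ((D + 1) * m + 1) :=
    (finProdFinEquiv.trans (finCongr hcard)).trans
      (finSumFinEquiv.symm.trans (Equiv.sumCongr (Equiv.refl _) finSumFinEquiv.symm))
  have hpos : ∀ s : Fin (m + 1) × Fin (D + 2),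
      (s.1 * (D + 2) + s.2 : ℕ) = (finProdFinEquiv s : ℕ) := fun s => by
    simp [finProdFinEquiv]; ring
  have he₁ : ∀ z, (finProdFinEquiv (e₁.symm z) : ℕ) =
      Sum.elim (fun k : Fin (m + 1) => (k : ℕ)) (Sum.elim (fun a : Fin D => m + 1 + (a : ℕ))
        (fun u : Fin ((D + 1) * m + 1) => m + 1 + (D + (u : ℕ)))) z := by
    rintro (k | a | u) <;> simp [e₁, Nat.mod_add_div]
  refine ⟨colour (D + 2) v,
    e₁.trans (Equiv.sumCongr (Equiv.refl _) (Equiv.sumCongr (Equiv.refl _) σ)),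
    colour_mod _ _, colour_zero hv, colour_last hv0 hv, fun l => colour_add hv hvw,
    fun s k hs => ?_, fun s a hs => ?_, fun s u hs => ?_⟩
  all_goals
    obtain ⟨z, rfl⟩ := e₁.symm.surjective s
    rw [hpos, he₁]
    simp only [Equiv.trans_apply, Equiv.apply_symm_apply] at hs
    rcases z with k' | a' | u' <;> simp at hs
  · subst hs; rfl
  · subst hs; rfl
  · subst hs
    refine ⟨by simp; omega, ?_⟩
    rw [hσ, ← colour_mod _ _ (m + 1 + D + u')]
    congr 1
    have := hpos (e₁.symm (Sum.inr (Sum.inr u')))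
    rw [he₁] at this
    simp only [Sum.elim_inr] at this
    generalize e₁.symm (Sum.inr (Sum.inr u')) = s at this ⊢
    rw [add_assoc, ← this, Nat.mul_add_mod_self_right]
    exact (Nat.mod_eq_of_lt s.2.is_lt).symm

/-! ### The trees -/

section Trees

variable {R : Type*} [Ring R] {m : ℕ} {x y : Fin (m + 1) → R}

/-- The leaves `x 0 ^ t * x (k + 1)`, for `t < r`, and `x 0 ^ r`. -/
def leafP (x : Fin (m + 1) → R) (r : ℕ) : Option (Fin r × Fin m) → R
  | none => x 0 ^ r
  | some s => x 0 ^ (s.1 : ℕ) * x s.2.succ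

/-- The leaves `y (k + 1) * y 0 ^ t`, for `t < r`, and `y 0 ^ r`. -/
def leafQ (y : Fin (m + 1) → R) (r : ℕ) : Option (Fin r × Fin m) → R
  | none => y 0 ^ r
  | some s => y s.2.succ * y 0 ^ (s.1 : ℕ)

theorem IsLeavittFamily.leaf (h : IsLeavittFamily x y) (r : ℕ) :
    IsLeavittFamily (leafP x r) (leafQ y r) where
  yx := by
    have h1 : ∀ (k : Fin m) {D E : ℕ}, D < E → y 0 ^ E * (x 0 ^ D * x k.succ) = 0 := by
      intro k D E hDE
      rw [← mul_assoc, h.pow_mul_pow_of_lt 0 hDE.le, show E - D = E - D - 1 + 1 by omega,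
        pow_succ, mul_assoc, h.yx, if_neg (Fin.succ_ne_zero k).symm, mul_zero]
    have h2 : ∀ (k : Fin m) {D E : ℕ}, D < E → y k.succ * y 0 ^ D * x 0 ^ E = 0 := by
      intro k D E hDE
      rw [show E = D + ((E - D - 1) + 1) by omega, pow_add, mul_assoc, ← mul_assoc (y 0 ^ D),
        h.pow_mul_pow, one_mul, pow_succ', ← mul_assoc, h.yx, if_neg (Fin.succ_ne_zero k),
        zero_mul]
    rintro (_ | ⟨t, k⟩) (_ | ⟨t', k'⟩)
    · simp [leafP, leafQ, h.pow_mul_pow]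
    · simp [leafP, leafQ, h1 k' t'.2]
    · simp [leafP, leafQ, h2 k t.2]
    · simp only [leafP, leafQ, Option.some.injEq, Prod.mk.injEq]
      rcases lt_trichotomy t t' with ht | rfl | ht
      · rw [← mul_assoc, h2 k (Fin.lt_def.1 ht), zero_mul, if_neg fun h' => ht.ne h'.1]
      · rw [mul_assoc, ← mul_assoc (y 0 ^ _), h.pow_mul_pow, one_mul, h.yx]
        simp
      · rw [mul_assoc, h1 k' (Fin.lt_def.1 ht), mul_zero, if_neg fun h' => ht.ne' h'.1]
  sum_xy := by
    have h1 : ∑ k : Fin m, x k.succ * y k.succ = 1 - x 0 * y 0 := by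
      rw [← h.sum_xy, Fin.sum_univ_succ, add_sub_cancel_left]
    have h2 : ∀ t : ℕ, ∑ k : Fin m, x 0 ^ t * x k.succ * (y k.succ * y 0 ^ t) =
        x 0 ^ t * y 0 ^ t - x 0 ^ (t + 1) * y 0 ^ (t + 1) := by
      intro t
      have : ∀ k : Fin m, x 0 ^ t * x k.succ * (y k.succ * y 0 ^ t) =
          x 0 ^ t * (x k.succ * y k.succ) * y 0 ^ t := fun k => by simp only [mul_assoc]
      simp only [this]
      rw [← Finset.sum_mul, ← Finset.mul_sum, h1, pow_succ, pow_succ']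
      simp only [mul_sub, sub_mul, mul_assoc, mul_one]
    rw [Fintype.sum_option, Fintype.sum_prod_type]
    simp only [leafP, leafQ, h2]
    rw [Fin.sum_univ_eq_sum_range (fun t => x 0 ^ t * y 0 ^ t - x 0 ^ (t + 1) * y 0 ^ (t + 1)),
      Finset.sum_range_sub']
    simp

/-- The number of the tree of a position. -/
def treeIndex {m D : ℕ} {Λ : Type*} : Fin (m + 1) ⊕ Fin D ⊕ Λ → Fin (D + 2) :=
  Sum.elim (fun _ => 0) (Sum.elim (fun a => a.succ.castSucc) fun _ => Fin.last _)

variable {D : ℕ} {Λ : Type*} [Fintype Λ] [DecidableEq Λ] {p q : Λ → R}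

theorem IsLeavittFamily.tree_yx (h : IsLeavittFamily x y) (h' : IsLeavittFamily p q)
    {z z' : Fin (m + 1) ⊕ Fin D ⊕ Λ} (hz : treeIndex z = treeIndex z') :
    Sum.elim y (Sum.elim 1 q) z * Sum.elim x (Sum.elim 1 p) z' = if z = z' then 1 else 0 := by
  rcases z with k | a | u <;> rcases z' with k' | a' | u' <;>
    simp_all [treeIndex, h.yx, h'.yx, Fin.ext_iff] <;> omega

theorem IsLeavittFamily.tree_sum (h : IsLeavittFamily x y) (h' : IsLeavittFamily p q)
    (a : Fin (D + 2)) :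
    ∑ z : Fin (m + 1) ⊕ Fin D ⊕ Λ, (if treeIndex z = a then
      Sum.elim x (Sum.elim 1 p) z * Sum.elim y (Sum.elim 1 q) z else 0) = 1 := by
  rw [Fintype.sum_sum_type, Fintype.sum_sum_type]
  induction a using Fin.lastCases with
  | last =>
    have h1 : ∀ a : Fin D, (a : ℕ) ≠ D := fun a => a.2.ne
    simp [treeIndex, Fin.ext_iff, h'.sum_xy, h1]
  | cast a =>
    induction a using Fin.cases with
    | zero =>
      simp [treeIndex, Fin.ext_iff, h.sum_xy]
    | succ a =>
      have h1 : Finset.univ.filter (fun b : Fin D => (b : ℕ) = a) = {a} := by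
        ext b
        simp [Fin.ext_iff]
      simp [treeIndex, Fin.ext_iff, a.2.ne', h1]

end Trees

/-! ### Generation -/

section Linked

variable {K R ι : Type*} [Field K] [Ring R] [Algebra K R] [Fintype ι] [DecidableEq ι]

/-- The matrix units at `(a, b)` and `(b, a)` belong to `S`. -/
def Linked (S : Subalgebra K (Matrix ι ι R)) (a b : ι) : Prop :=
  Matrix.single a b 1 ∈ S ∧ Matrix.single b a 1 ∈ S

variable {S : Subalgebra K (Matrix ι ι R)}

theorem single_mul_mem {a b c : ι} {r s : R} (h : Matrix.single a b r ∈ S)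
    (h' : Matrix.single b c s ∈ S) : Matrix.single a c (r * s) ∈ S := by
  have := mul_mem h h'
  rwa [Matrix.single_mul_single_same] at this

theorem single_pow_mem {a : ι} {r : R} (h1 : Matrix.single a a 1 ∈ S)
    (h : Matrix.single a a r ∈ S) (n : ℕ) : Matrix.single a a (r ^ n) ∈ S := by
  induction n with
  | zero => simpa
  | succ n ih => rw [pow_succ]; exact single_mul_mem ih h

theorem Linked.symm {a b : ι} (h : Linked S a b) : Linked S b a := ⟨h.2, h.1⟩

theorem Linked.trans {a b c : ι} (h : Linked S a b) (h' : Linked S b c) : Linked S a c :=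
  ⟨by simpa using single_mul_mem h.1 h'.1, by simpa using single_mul_mem h'.2 h.2⟩

theorem Linked.single_right {a b c : ι} (h : Linked S a b) {r : R}
    (hr : Matrix.single c a r ∈ S) : Matrix.single c b r ∈ S := by
  simpa using single_mul_mem hr h.1

theorem Linked.single_left {a b c : ι} (h : Linked S a b) {r : R}
    (hr : Matrix.single a c r ∈ S) : Matrix.single b c r ∈ S := by
  simpa using single_mul_mem h.2 hr

theorem eq_top_of_linked {X : Set R} (hX : Algebra.adjoin K X = ⊤) (o : ι)
    (hlink : ∀ a, Linked S o a) (h : ∀ r ∈ X, Matrix.single o o r ∈ S) : S = ⊤ := by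
  have ho : ∀ r, Matrix.single o o r ∈ S := by
    intro r
    have hr : r ∈ Algebra.adjoin K X := hX ▸ Algebra.mem_top
    induction hr using Algebra.adjoin_induction with
    | mem r hr => exact h r hr
    | algebraMap c =>
      rw [Algebra.algebraMap_eq_smul_one, ← Matrix.smul_single]
      exact S.smul_mem (hlink o).1 c
    | add a b _ _ ha hb => rw [Matrix.single_add]; exact add_mem ha hb
    | mul a b _ _ ha hb => exact single_mul_mem ha hb
  rw [eq_top_iff]
  intro M _
  rw [Matrix.matrix_eq_sum_single M]
  exact sum_mem fun a _ => sum_mem fun b _ =>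
    (hlink b).single_right ((hlink a).single_left (ho _))

end Linked

section Generation

variable {K R : Type*} [Field K] [Ring R] [Algebra K R] {D m : ℕ}
  {S : Subalgebra K (Matrix (Fin (D + 2)) (Fin (D + 2)) R)}

/-- If every diagonal projection below `l` is obtained from the one below `l + m`, then the
diagonal matrix units belong to `S`. -/
theorem single_self_mem_of_step (h : Nat.Coprime (D + 2) m)
    (hstep : ∀ l, 1 ≤ l → l ≤ D + 1 →
      Matrix.diagonal (fun j : Fin (D + 2) => if (j : ℕ) < (l + m) % (D + 2) then (1 : R) else 0)
        ∈ S →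
      Matrix.diagonal (fun j : Fin (D + 2) => if (j : ℕ) < l then (1 : R) else 0) ∈ S)
    (a : Fin (D + 2)) : Matrix.single a a 1 ∈ S := by
  have hlow : ∀ T l, l < D + 2 → (l + T * m) % (D + 2) = 0 →
      Matrix.diagonal (fun j : Fin (D + 2) => if (j : ℕ) < l then (1 : R) else 0) ∈ S := by
    intro T
    induction T with
    | zero =>
      intro l hl h0
      have : l = 0 := by simpa [Nat.mod_eq_of_lt hl] using h0
      simp [this]
    | succ T ih =>
      intro l hl h0
      rcases Nat.eq_zero_or_pos l with rfl | hpos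
      · simp
      · refine hstep l hpos (by omega) (ih _ (Nat.mod_lt _ (by omega)) ?_)
        rw [Nat.mod_add_mod, ← h0]
        congr 1
        ring
  have hall : ∀ l, l ≤ D + 2 →
      Matrix.diagonal (fun j : Fin (D + 2) => if (j : ℕ) < l then (1 : R) else 0) ∈ S := by
    intro l hl
    rcases hl.lt_or_eq with hl | rfl
    · obtain ⟨T, hT⟩ := h.exists_add_mul_mod (by omega) l 0
      exact hlow T l hl (by simpa using hT)
    · simp
  have := sub_mem (hall (a + 1) (by omega)) (hall a (by omega))
  convert this using 1
  rw [Matrix.diagonal_sub, ← Matrix.diagonal_single]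
  congr 1
  ext j
  rw [Pi.single_apply]
  rcases lt_trichotomy j a with hj | rfl | hj
  · simp [hj.ne, Fin.lt_def.1 hj, (Fin.lt_def.1 hj).le]
  · simp
  · have := Fin.lt_def.1 hj
    simp [hj.ne', show ¬ (j : ℕ) < a + 1 by omega, show ¬ (j : ℕ) < a by omega]

/-- Links between `l` and `l + m` connect every residue to `0` or to the last residue. -/
theorem linked_of_step (h : Nat.Coprime (D + 2) m) (hself : ∀ a, Linked S a a)
    (hstep : ∀ l, 1 ≤ l → l ≤ D →
      Linked S (Fin.ofNat (D + 2) l) (Fin.ofNat (D + 2) (l + m)))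
    {g : ℕ → Bool} (hper : ∀ N, g (N % (D + 2)) = g N) (h0 : g 0 = false)
    (h1 : g (D + 1) = true) (hg : ∀ l, 1 ≤ l → l ≤ D → g (l + m) = g l) (a : Fin (D + 2)) :
    Linked S a (if g a = true then Fin.last (D + 1) else 0) := by
  have key : ∀ (c : Bool) (T l : ℕ), l < D + 2 →
      (l + T * m) % (D + 2) = (if c = true then D + 1 else 0) → g l = c →
      Linked S (Fin.ofNat (D + 2) l) (if c = true then Fin.last (D + 1) else 0) := by
    intro c T
    have base : ∀ l, l < D + 2 → l = (if c = true then D + 1 else 0) →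
        Linked S (Fin.ofNat (D + 2) l) (if c = true then Fin.last (D + 1) else 0) := by
      rintro l hl rfl
      convert hself _
      cases c <;> simp
    induction T with
    | zero =>
      intro l hl hT _
      exact base l hl (by simpa [Nat.mod_eq_of_lt hl] using hT)
    | succ T ih =>
      intro l hl hT hgl
      by_cases hl' : 1 ≤ l ∧ l ≤ D
      · refine (hstep l hl'.1 hl'.2).trans ?_
        have := ih ((l + m) % (D + 2)) (Nat.mod_lt _ (by omega)) ?_ ?_
        · convert this using 1
          simp [Fin.ext_iff]
        · rw [Nat.mod_add_mod, ← hT]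
          congr 1
          ring
        · rw [hper, hg l hl'.1 hl'.2, hgl]
      · apply base l hl
        have : l = 0 ∨ l = D + 1 := by omega
        rcases this with rfl | rfl <;> cases c <;> simp_all
  obtain ⟨T, hT⟩ := h.exists_add_mul_mod (by omega) a (if g a = true then D + 1 else 0)
  have := key (g a) T a a.2 (by rw [hT]; split_ifs <;> simp [Nat.mod_eq_of_lt]) rfl
  convert this using 1
  simp

end Generation

theorem Fin.eq_ofNat_of_mul_add_eq {D i N : ℕ} (j : Fin (D + 2)) (h : i * (D + 2) + j = N) :
    j = Fin.ofNat (D + 2) N := by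
  ext
  rw [Fin.val_ofNat, ← h, Nat.mul_add_mod_self_right, Nat.mod_eq_of_lt j.2]

theorem IsLeavittFamily.exists_generating {K R : Type*} [Field K] [Ring R] [Algebra K R]
    {D m : ℕ} {x y : Fin (m + 1) → R} (h : IsLeavittFamily x y)
    (hgen : Algebra.adjoin K (Set.range x ∪ Set.range y) = ⊤) (hcop : Nat.Coprime (D + 2) m) :
    ∃ X Y : Fin (m + 1) → Matrix (Fin (D + 2)) (Fin (D + 2)) R, IsLeavittFamily X Y ∧
      Algebra.adjoin K (Set.range X ∪ Set.range Y) = ⊤ := by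
  obtain ⟨g, e, hper, hg0, hg1, hgstep, he0, he1, he2⟩ := exists_partition hcop
  have hleaf := h.leaf (D + 1)
  let t : Fin (m + 1) × Fin (D + 2) → Fin (D + 2) := fun s => treeIndex (e s)
  let p : Fin (m + 1) × Fin (D + 2) → R := fun s =>
    Sum.elim x (Sum.elim 1 (leafP x (D + 1))) (e s)
  let q : Fin (m + 1) × Fin (D + 2) → R := fun s =>
    Sum.elim y (Sum.elim 1 (leafQ y (D + 1))) (e s)
  have hqp : ∀ s s', t s = t s' → q s * p s' = if s = s' then 1 else 0 := fun s s' hs => by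
    simpa using h.tree_yx hleaf hs
  have hpq : ∀ a, ∑ s, (if t s = a then p s * q s else 0) = 1 := fun a => by
    rw [← h.tree_sum hleaf a]
    exact e.sum_comp (fun z => if treeIndex z = a then
      Sum.elim x (Sum.elim 1 (leafP x (D + 1))) z * Sum.elim y (Sum.elim 1 (leafQ y (D + 1))) z
      else 0)
  refine ⟨colX t p, colY t q, isLeavittFamily_col hqp hpq, ?_⟩
  set S := Algebra.adjoin K (Set.range (colX t p) ∪ Set.range (colY t q))
  have hX : ∀ i, colX t p i ∈ S := fun i => Algebra.subset_adjoin (Or.inl ⟨i, rfl⟩)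
  have hY : ∀ i, colY t q i ∈ S := fun i => Algebra.subset_adjoin (Or.inr ⟨i, rfl⟩)
  have hself : ∀ a, Matrix.single a a 1 ∈ S := by
    refine single_self_mem_of_step hcop fun l hl1 hl2 hmem => ?_
    rw [← sum_colX_mul_diagonal_mul_colY hpq (fun i j => (i : ℕ) * (D + 2) + j < m + l)
      (fun a => (a : ℕ) < l)]
    · refine sum_mem fun i _ => mul_mem (mul_mem (hX i) ?_) (hY i)
      rcases le_or_gt (m + l) (i * (D + 2)) with h1 | h1
      · convert zero_mem S
        rw [← Matrix.diagonal_zero]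
        congr 1
        ext j
        rw [if_neg (by omega)]
      · rcases le_or_gt (i * (D + 2) + (D + 2)) (m + l) with h2 | h2
        · convert one_mem S
          rw [← Matrix.diagonal_one]
          congr 1
          ext j
          rw [if_pos (by omega)]
        · have h3 : (l + m) % (D + 2) = m + l - i * (D + 2) := by
            have : l + m = i * (D + 2) + (m + l - i * (D + 2)) := by omega
            rw [this, Nat.mul_add_mod_self_right, Nat.mod_eq_of_lt (by omega)]
          convert hmem using 4
          rw [h3]
          omega
    · intro s
      simp only [t]
      rcases hs : e s with k | a | u
      · have := he0 s k hs
        simp [treeIndex]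
        omega
      · have := he1 s a hs
        simp [treeIndex]
        omega
      · have := (he2 s u hs).1
        simp [treeIndex]
        omega
  have hP : ∀ s, Matrix.single (t s) s.2 (p s) ∈ S := fun s => by
    rw [← single_mul_colX_mul_single]
    exact mul_mem (mul_mem (hself _) (hX _)) (hself _)
  have hQ : ∀ s, Matrix.single s.2 (t s) (q s) ∈ S := fun s => by
    rw [← single_mul_colY_mul_single]
    exact mul_mem (mul_mem (hself _) (hY _)) (hself _)
  have hstep : ∀ l, 1 ≤ l → l ≤ D →
      Linked S (Fin.ofNat (D + 2) l) (Fin.ofNat (D + 2) (l + m)) := by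
    intro l hl1 hl2
    obtain ⟨s, hs⟩ := e.surjective (Sum.inr (Sum.inl ⟨l - 1, by omega⟩))
    have h1 := Fin.eq_ofNat_of_mul_add_eq s.2 (he1 s _ hs)
    have h2 : t s = Fin.ofNat (D + 2) l := by
      ext
      simp only [t, hs, treeIndex, Fin.val_ofNat, Nat.mod_eq_of_lt (show l < D + 2 by omega)]
      simp
      omega
    rw [show m + 1 + ((⟨l - 1, by omega⟩ : Fin D) : ℕ) = l + m by simp; omega] at h1
    have h3 := hP s
    have h4 := hQ s
    rw [h1, h2] at h3 h4
    simp only [p, q, hs, Sum.elim_inr, Sum.elim_inl, Pi.one_apply] at h3 h4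
    exact ⟨h3, h4⟩
  have hend := linked_of_step hcop (fun a => ⟨hself a, hself a⟩) hstep hper hg0 hg1 hgstep
  have hconn : ∀ a b : Fin (D + 2), g a = g b → Linked S a b := fun a b hab => by
    have := hend b
    rw [← hab] at this
    exact (hend a).trans this.symm
  have hletter : ∀ k : Fin (m + 1), Matrix.single 0 (Fin.ofNat (D + 2) k) (x k) ∈ S ∧
      Matrix.single (Fin.ofNat (D + 2) k) 0 (y k) ∈ S := by
    intro k
    obtain ⟨s, hs⟩ := e.surjective (Sum.inl k)
    have h1 := Fin.eq_ofNat_of_mul_add_eq s.2 (he0 s _ hs)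
    have h3 := hP s
    have h4 := hQ s
    rw [h1] at h3 h4
    simp only [p, q, t, hs, treeIndex, Sum.elim_inl] at h3 h4
    exact ⟨h3, h4⟩
  have hletter0 : Matrix.single 0 0 (x 0) ∈ S ∧ Matrix.single 0 0 (y 0) ∈ S := by
    simpa using hletter 0
  have hleafmem : ∀ (u : Option (Fin (D + 1) × Fin m)) (c : Fin (D + 2)), g c = leafColour g u →
      Matrix.single 0 c (leafP x (D + 1) u) ∈ S ∧ Matrix.single c 0 (leafQ y (D + 1) u) ∈ S := by
    rintro (_ | ⟨r, k⟩) c hc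
    · have hl : Linked S 0 c := hconn 0 c (by rw [hc]; exact hg0)
      exact ⟨hl.single_right (single_pow_mem (hself 0) hletter0.1 _),
        hl.single_left (single_pow_mem (hself 0) hletter0.2 _)⟩
    · have hl : Linked S (Fin.ofNat (D + 2) (k.succ : Fin (m + 1))) c :=
        hconn _ c (by rw [hc, Fin.val_ofNat, hper]; simp [leafColour])
      exact ⟨hl.single_right (single_mul_mem (single_pow_mem (hself 0) hletter0.1 _)
          (hletter k.succ).1),
        hl.single_left (single_mul_mem (hletter k.succ).2
          (single_pow_mem (hself 0) hletter0.2 _))⟩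
  have hlast : Linked S 0 (Fin.last (D + 1)) := by
    have hsplit : ∀ u, ∃ c, (Matrix.single 0 c (leafP x (D + 1) u) ∈ S ∧
        Matrix.single c 0 (leafQ y (D + 1) u) ∈ S) ∧
        Matrix.single (Fin.last (D + 1)) c (leafP x (D + 1) u) ∈ S ∧
        Matrix.single c (Fin.last (D + 1)) (leafQ y (D + 1) u) ∈ S := by
      intro u
      obtain ⟨s, hs⟩ := e.surjective (Sum.inr (Sum.inr u))
      have h3 := hP s
      have h4 := hQ s
      simp only [p, q, t, hs, treeIndex, Sum.elim_inr] at h3 h4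
      exact ⟨s.2, hleafmem u s.2 (he2 s u hs).2, h3, h4⟩
    have hsum : ∀ a b : Fin (D + 2), Matrix.single a b (1 : R) =
        ∑ u, Matrix.single a b (leafP x (D + 1) u * leafQ y (D + 1) u) := fun a b => by
      rw [← hleaf.sum_xy]
      exact map_sum (Matrix.singleAddMonoidHom a b) _ _
    constructor
    · rw [hsum]
      refine sum_mem fun u _ => ?_
      obtain ⟨c, h1, h2⟩ := hsplit u
      exact single_mul_mem h1.1 h2.2
    · rw [hsum]
      refine sum_mem fun u _ => ?_
      obtain ⟨c, h1, h2⟩ := hsplit u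
      exact single_mul_mem h2.1 h1.2
  have hlink : ∀ a, Linked S 0 a := fun a => by
    have := hend a
    split_ifs at this
    · exact hlast.trans this.symm
    · exact this.symm
  refine eq_top_of_linked hgen 0 hlink ?_
  rintro _ (⟨k, rfl⟩ | ⟨k, rfl⟩)
  · exact (hlink _).symm.single_right (hletter k).1
  · exact (hlink _).symm.single_left (hletter k).2

/-! ### Sufficiency of the condition on greatest common divisors -/

namespace LeavittAlgebra

variable {K : Type} [Field K] {m : ℕ}

theorem bijective_of_adjoin_eq_top {A : Type*} [Ring A] [Algebra K A] [Nontrivial A] (hm : 0 < m)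
    {X Y : Fin (m + 1) → A} {φ : LeavittAlgebra K (m + 1) →ₐ[K] A}
    (hX : ∀ i, φ (x K (m + 1) i) = X i) (hY : ∀ i, φ (y K (m + 1) i) = Y i)
    (hgen : Algebra.adjoin K (Set.range X ∪ Set.range Y) = ⊤) : Function.Bijective φ := by
  constructor
  · rw [injective_iff_map_eq_zero]
    intro a ha
    by_contra h0
    obtain ⟨p, q, hpq⟩ := (isLeavittFamily K (m + 1)).exists_mul_mul_eq_one hm
      (adjoin_eq_top K (m + 1)) h0
    have := congrArg φ hpq
    simp [ha] at this
  · rw [← AlgHom.range_eq_top, eq_top_iff, ← hgen, Algebra.adjoin_le_iff]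
    rintro _ (⟨i, rfl⟩ | ⟨i, rfl⟩)
    · exact ⟨_, hX i⟩
    · exact ⟨_, hY i⟩

theorem nontrivial_leavittAlgebra (K : Type) [Field K] (n : ℕ) [NeZero n] :
    Nontrivial (LeavittAlgebra K n) := by
  have := (linearIndependent_yWord (K := K) (n := n)).ne_zero []
  exact ⟨_, _, this⟩

theorem nonempty_algEquiv_matrix_fin_one (K A : Type*) [CommSemiring K] [Semiring A] [Algebra K A] :
    Nonempty (A ≃ₐ[K] Matrix (Fin 1) (Fin 1) A) :=
  ⟨AlgEquiv.ofBijective (Matrix.scalarAlgHom (Fin 1) K)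
    ⟨fun a b h => by simpa using congrFun (congrFun h 0) 0, fun M => ⟨M 0 0, by
      ext i j
      rw [Subsingleton.elim i 0, Subsingleton.elim j 0]
      simp⟩⟩⟩

theorem nonempty_algEquiv_matrix_of_coprime (hm : 0 < m) {u : ℕ} (hu : 0 < u)
    (h : Nat.Coprime u m) :
    Nonempty (LeavittAlgebra K (m + 1) ≃ₐ[K]
      Matrix (Fin u) (Fin u) (LeavittAlgebra K (m + 1))) := by
  match u, hu with
  | 1, _ => exact nonempty_algEquiv_matrix_fin_one K _
  | D + 2, _ =>
    have := nontrivial_leavittAlgebra K (m + 1)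
    obtain ⟨X, Y, hXY, hgen⟩ := (isLeavittFamily K (m + 1)).exists_generating
      (adjoin_eq_top K (m + 1)) h
    obtain ⟨φ, hX, hY⟩ := exists_lift (K := K) hXY
    exact ⟨AlgEquiv.ofBijective φ (bijective_of_adjoin_eq_top hm hX hY hgen)⟩

end LeavittAlgebra

theorem Nat.exists_coprime_mul_eq_add {d m : ℕ} (hd : 0 < d) (hm : 0 < m) :
    ∃ u j, 0 < u ∧ Nat.Coprime u m ∧ Nat.gcd d m * u = d + j * m := by
  obtain ⟨u, hu⟩ := Nat.gcd_dvd_left d m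
  obtain ⟨k, hk⟩ := Nat.gcd_dvd_right d m
  have hg : 0 < Nat.gcd d m := Nat.gcd_pos_of_pos_left m hd
  have huk : Nat.Coprime u k := by
    have := Nat.coprime_div_gcd_div_gcd hg
    rwa [Nat.div_eq_of_eq_mul_right hg hu, Nat.div_eq_of_eq_mul_right hg hk] at this
  set g := Nat.gcd d m
  have hkm : k ∣ m := ⟨g, by rw [hk, mul_comm]⟩
  have : NeZero m := ⟨hm.ne'⟩
  obtain ⟨w, hw⟩ := ZMod.unitsMap_surjective hkm (ZMod.unitOfCoprime u huk)
  have hu0 : 0 < u := Nat.pos_of_ne_zero fun h0 => by simp [h0] at hu; omega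
  have hmod : (w : ZMod m).val ≡ u [MOD k] := by
    rw [← ZMod.natCast_eq_natCast_iff]
    have := congrArg Units.val hw
    rw [ZMod.coe_unitOfCoprime, ZMod.unitsMap_val] at this
    rw [← this, ZMod.natCast_val]
  have hmod' : u ≡ (w : ZMod m).val + u * m [MOD k] := by
    refine hmod.symm.trans ?_
    have := (Nat.modEq_zero_iff_dvd.2 (hkm.mul_left u)).add_left (w : ZMod m).val
    exact this.symm
  have hle : u ≤ (w : ZMod m).val + u * m := by nlinarith
  obtain ⟨j, hj⟩ := (Nat.modEq_iff_dvd' hle).1 hmod'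
  refine ⟨(w : ZMod m).val + u * m, j, by omega, ?_, ?_⟩
  · rw [Nat.coprime_add_mul_right_left]
    exact ZMod.val_coe_unit_coprime w
  · rw [show (w : ZMod m).val + u * m = u + k * j by omega, mul_add, ← hu, ← mul_assoc, ← hk,
      mul_comm j]

namespace LeavittAlgebra

variable {K : Type} [Field K] {m : ℕ}

theorem nonempty_algEquiv_matrix_gcd (hm : 0 < m) {d : ℕ} (hd : 0 < d) :
    Nonempty (Matrix (Fin d) (Fin d) (LeavittAlgebra K (m + 1)) ≃ₐ[K]
      Matrix (Fin (Nat.gcd d m)) (Fin (Nat.gcd d m)) (LeavittAlgebra K (m + 1))) := by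
  obtain ⟨u, j, hu, hcop, huj⟩ := Nat.exists_coprime_mul_eq_add hd hm
  obtain ⟨e₁⟩ := nonempty_algEquiv_matrix_of_coprime (K := K) hm hu hcop
  obtain ⟨e₂⟩ := (RectIso.fin_add (isLeavittFamily K (m + 1)) hd j).nonempty_algEquiv K
  exact ⟨e₂.trans ((((Matrix.reindexAlgEquiv K _
    (finProdFinEquiv.trans (finCongr huj))).symm).trans
    (Matrix.compAlgEquiv (Fin (Nat.gcd d m)) (Fin u) (LeavittAlgebra K (m + 1)) K).symm).trans
    e₁.symm.mapMatrix)⟩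

theorem nonempty_matrix_algEquiv_iff (hm : 0 < m) {d d' : ℕ} (hd : 0 < d) (hd' : 0 < d') :
    Nonempty (Matrix (Fin d) (Fin d) (LeavittAlgebra K (m + 1)) ≃ₐ[K]
      Matrix (Fin d') (Fin d') (LeavittAlgebra K (m + 1))) ↔ Nat.gcd d m = Nat.gcd d' m := by
  constructor
  · rintro ⟨e⟩
    exact Nat.dvd_antisymm
      (Nat.dvd_gcd (gcd_dvd_of_algEquiv hm hd e) (Nat.gcd_dvd_right _ _))
      (Nat.dvd_gcd (gcd_dvd_of_algEquiv hm hd' e.symm) (Nat.gcd_dvd_right _ _))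
  · intro h
    obtain ⟨e⟩ := nonempty_algEquiv_matrix_gcd (K := K) hm hd
    obtain ⟨e'⟩ := nonempty_algEquiv_matrix_gcd (K := K) hm hd'
    rw [← h] at e'
    exact ⟨e.trans e'.symm⟩

end LeavittAlgebra

/-- **Matrix rings over Leavitt algebras** (Abrams–Ánh–Pardo).  For `n ≥ 2` and positive
integers `d, d'`:  `L_K(1,n) ≅ M_d(L_K(1,n))` as `K`-algebras iff `gcd(d, n-1) = 1`, and
more generally `M_d(L_K(1,n)) ≅ M_{d'}(L_K(1,n))` iff `gcd(d, n-1) = gcd(d', n-1)`. -/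
theorem matrix_rings_over_leavitt (K : Type) [Field K] (n d d' : ℕ)
    (hn : 2 ≤ n) (hd : 0 < d) (hd' : 0 < d') :
    (Nonempty (LeavittAlgebra K n ≃ₐ[K] Matrix (Fin d) (Fin d) (LeavittAlgebra K n)) ↔
        Nat.gcd d (n - 1) = 1) ∧
      (Nonempty (Matrix (Fin d) (Fin d) (LeavittAlgebra K n) ≃ₐ[K]
          Matrix (Fin d') (Fin d') (LeavittAlgebra K n)) ↔
        Nat.gcd d (n - 1) = Nat.gcd d' (n - 1)) := by
  obtain ⟨m, rfl⟩ : ∃ m, n = m + 1 := ⟨n - 1, by omega⟩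
  have hm : 0 < m := by omega
  rw [Nat.add_sub_cancel]
  refine ⟨?_, LeavittAlgebra.nonempty_matrix_algEquiv_iff hm hd hd'⟩
  obtain ⟨e⟩ := LeavittAlgebra.nonempty_algEquiv_matrix_fin_one K (LeavittAlgebra K (m + 1))
  have h := LeavittAlgebra.nonempty_matrix_algEquiv_iff (K := K) hm one_pos hd
  rw [Nat.gcd_one_left, eq_comm] at h
  rw [← h]
  exact ⟨fun ⟨f⟩ => ⟨e.symm.trans f⟩, fun ⟨f⟩ => ⟨e.trans f⟩⟩
end
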